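/- arXiv:1307.2805 — 2 statements merged into one kernel-verified Lean document; each statement's English description precedes it below -/
import Mathlib

section
/- Free energy estimate in the high-temperature regime (d ≥ 3): Let d ≥ 3 and let V : ℝ^d → ℝ be continuous with V(x) → +∞ as |x| → ∞ and ∫ e^{−β_1 V(x)/2} dx < ∞ for some β_1 > 0. Fix constants c_1, c_2, C_0 > 0. Let n ≥ 1 and β > 0 satisfy c_1 n^{−1} ≤ β ≤ c_2 n^{2/d−1} and nβ ≥ β_1. Let μ_β be a probability density on ℝ^d with 0 < μ_β(x) ≤ C_0 for all x, with D(μ_β,μ_β) ≤ C_0, with ∫ V μ_β and ∫ μ_β |log μ_β| finite, and satisfying for every x ∈ ℝ^d the variational equation 2(w*μ_β)(x) + V(x) + (2/(nβ)) log μ_β(x) = F[μ_β] + D(μ_β,μ_β), where F[μ] = E[μ] + (2/(nβ)) ∫ μ log μ. Define F_{n,β} = −(2/β) log ∫_{(ℝ^d)^n} exp( −(β/2) H_n(x_1,…,x_n) ) dx_1 … dx_n. Then there exist C > 0 and n_0, depending only on d, ρ, c_1, c_2, C_0 and β_1, such that for all n ≥ n_0: | F_{n,β} − n² E[μ_β]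 − (2n/β) ∫ μ_β log μ_β | ≤ C n^{2−2/d}. -/
open MeasureTheory Metric Real Filter
open scoped Topology ENNReal BigOperators

noncomputable section

/-- Euclidean space `ℝ^d`. -/
abbrev Euc (d : ℕ) := EuclideanSpace ℝ (Fin d)

/-- The Coulomb kernel for `d ≥ 3`: `w(x) = |x|^{2-d}`. -/
def ck (d : ℕ) (x : Euc d) : ℝ :=
  if d = 2 then -Real.log ‖x‖ else ‖x‖ ^ ((2 : ℝ) - d)

/-- The smeared Dirac mass `δ_p^{(η)}`: density `ρ_η(x - p)` with `ρ_η(x) = η^{-d} ρ(x/η)`. -/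
def smear (d : ℕ) (ρ : Euc d → ℝ) (η : ℝ) (p : Euc d) (x : Euc d) : ℝ :=
  (η ^ d)⁻¹ * ρ (η⁻¹ • (x - p))

/-- The Coulomb interaction `D(f,g) = ∬ w(x-y) f(x) g(y) dx dy` of two densities. -/
def coulombPair (d : ℕ) (f g : Euc d → ℝ) : ℝ :=
  ∫ z : Euc d × Euc d, ck d (z.1 - z.2) * f z.1 * g z.2

/-- The Hamiltonian `H_n(x) = Σ_{i≠j} w(x_i − x_j) + n Σ_i V(x_i)`. -/
def coulombHam (d : ℕ) (V : Euc d → ℝ) (n : ℕ) (x : Fin n → Euc d) : ℝ :=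
  (∑ i : Fin n, ∑ j : Fin n, if i ≠ j then ck d (x i - x j) else 0)
    + (n : ℝ) * ∑ i, V (x i)

/-- The mean-field energy `E[μ] = D(μ,μ) + ∫ V dμ` of a density `μ`. -/
def mfEnergy (d : ℕ) (V : Euc d → ℝ) (μ : Euc d → ℝ) : ℝ :=
  coulombPair d μ μ + ∫ x, V x * μ x

/-- The mean-field free energy `F[μ] = E[μ] + (2/(nβ)) ∫ μ log μ`. -/
def mfFreeEnergy (d : ℕ) (V : Euc d → ℝ) (n : ℕ) (β : ℝ) (μ : Euc d → ℝ) : ℝ :=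
  mfEnergy d V μ + 2 / (n * β) * ∫ x, μ x * Real.log (μ x)

/-- The `n`-body free energy `F_{n,β} = −(2/β) log ∫ exp(−(β/2) H_n)`. -/
def freeEnergy (d : ℕ) (V : Euc d → ℝ) (n : ℕ) (β : ℝ) : ℝ :=
  -(2 / β) * Real.log (∫ x : Fin n → Euc d, Real.exp (-(β / 2) * coulombHam d V n x))

section PositiveDefinite

variable {X P : Type*} [MeasurableSpace X] [MeasurableSpace P]

/-- Tonelli for a kernel of the form `K x y = ∫⁻ p, Φ p x * Φ p y`. -/
lemma lintegral_lintegral_factored_kernel (κ : Measure P) [SFinite κ] (σ τ : Measure X)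
    [SFinite σ] [SFinite τ] {Φ : P → X → ℝ≥0∞} (hΦ : Measurable (Function.uncurry Φ)) :
    ∫⁻ x, ∫⁻ y, ∫⁻ p, Φ p x * Φ p y ∂κ ∂τ ∂σ
      = ∫⁻ p, (∫⁻ x, Φ p x ∂σ) * ∫⁻ y, Φ p y ∂τ ∂κ := by
  have hΦ' : ∀ p, Measurable (Φ p) := fun p => hΦ.comp measurable_prodMk_left
  have hΦ'' : ∀ x, Measurable fun p => Φ p x := fun x => hΦ.comp measurable_prodMk_right
  have hA : Measurable fun p => ∫⁻ y, Φ p y ∂τ := hΦ.lintegral_prod_right'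
  calc ∫⁻ x, ∫⁻ y, ∫⁻ p, Φ p x * Φ p y ∂κ ∂τ ∂σ
      = ∫⁻ x, ∫⁻ p, Φ p x * ∫⁻ y, Φ p y ∂τ ∂κ ∂σ := by
        refine lintegral_congr fun x => ?_
        rw [lintegral_lintegral_swap]
        · exact lintegral_congr fun p => lintegral_const_mul _ (hΦ' p)
        · exact (((hΦ'' x).comp measurable_snd).mul (hΦ.comp measurable_swap)).aemeasurable
    _ = _ := by
        rw [lintegral_lintegral_swap]
        · exact lintegral_congr fun p => lintegral_mul_const _ (hΦ' p)
        · exact ((hΦ.comp measurable_swap).mul (hA.comp measurable_snd)).aemeasurable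

lemma ENNReal.two_mul_mul_le_sq_add_sq (a b : ℝ≥0∞) : 2 * (a * b) ≤ a * a + b * b := by
  rcases eq_or_ne a ∞ with rfl | ha
  · simp
  rcases eq_or_ne b ∞ with rfl | hb
  · simp
  lift a to NNReal using ha
  lift b to NNReal using hb
  norm_cast
  have := two_mul_le_add_sq (a : ℝ) b
  rw [← NNReal.coe_le_coe]
  push_cast
  nlinarith

/-- A kernel of the form `K x y = ∫⁻ p, Φ p x * Φ p y` is positive definite: the energy of
`σ - τ` is nonnegative. -/
lemma two_mul_lintegral_factored_kernel_le (κ : Measure P) [SFinite κ] (σ τ : Measure X)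
    [SFinite σ] [SFinite τ] {Φ : P → X → ℝ≥0∞} (hΦ : Measurable (Function.uncurry Φ)) :
    2 * ∫⁻ x, ∫⁻ y, ∫⁻ p, Φ p x * Φ p y ∂κ ∂τ ∂σ
      ≤ ∫⁻ x, ∫⁻ y, ∫⁻ p, Φ p x * Φ p y ∂κ ∂σ ∂σ
        + ∫⁻ x, ∫⁻ y, ∫⁻ p, Φ p x * Φ p y ∂κ ∂τ ∂τ := by
  have hσ : Measurable fun p => ∫⁻ y, Φ p y ∂σ := hΦ.lintegral_prod_right'
  have hτ : Measurable fun p => ∫⁻ y, Φ p y ∂τ := hΦ.lintegral_prod_right'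
  simp only [lintegral_lintegral_factored_kernel κ _ _ hΦ]
  rw [← lintegral_const_mul _ (by fun_prop),
    ← lintegral_add_left (by fun_prop)]
  exact lintegral_mono fun p => ENNReal.two_mul_mul_le_sq_add_sq _ _

end PositiveDefinite

section GaussianDecomposition

/-- The Gaussian component at inverse scale `t` of the Coulomb kernel, so that
`|x|^{2-d} = ∫_0^∞ gaussComponent d t x dt`. -/
def gaussComponent (d : ℕ) (t : ℝ) (x : Euc d) : ℝ :=
  t ^ ((d : ℝ) / 2 - 2) * Real.exp (-t * ‖x‖ ^ 2) / Real.Gamma ((d : ℝ) / 2 - 1)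

/-- The regular, long-range part of the Coulomb kernel. -/
def longRange (d : ℕ) (T : ℝ) (x : Euc d) : ℝ≥0∞ :=
  ∫⁻ t in Set.Ioc 0 T, ENNReal.ofReal (gaussComponent d t x)

/-- The singular, short-range part of the Coulomb kernel. -/
def shortRange (d : ℕ) (T : ℝ) (x : Euc d) : ℝ≥0∞ :=
  ∫⁻ t in Set.Ioi T, ENNReal.ofReal (gaussComponent d t x)

lemma measurable_gaussComponent (d : ℕ) :
    Measurable fun z : ℝ × Euc d => gaussComponent d z.1 z.2 := by
  unfold gaussComponent
  fun_prop

lemma half_dim_sub_one_pos {d : ℕ} (hd : 3 ≤ d) : 0 < (d : ℝ) / 2 - 1 := by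
  have : (3 : ℝ) ≤ d := by exact_mod_cast hd
  linarith

lemma gaussComponent_nonneg {d : ℕ} (hd : 3 ≤ d) {t : ℝ} (ht : 0 ≤ t) (x : Euc d) :
    0 ≤ gaussComponent d t x := by
  have := Real.Gamma_pos_of_pos (half_dim_sub_one_pos hd)
  unfold gaussComponent
  positivity

lemma longRange_add_shortRange {d : ℕ} (hd : 3 ≤ d) {T : ℝ} (hT : 0 ≤ T) {x : Euc d}
    (hx : x ≠ 0) : longRange d T x + shortRange d T x = ENNReal.ofReal (ck d x) := by
  have hx' : 0 < ‖x‖ := norm_pos_iff.2 hx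
  have ha := half_dim_sub_one_pos hd
  have hΓ := Real.Gamma_pos_of_pos ha
  have hd2 : d ≠ 2 := by omega
  have hint : ∫ t in Set.Ioi (0 : ℝ), gaussComponent d t x = ck d x := by
    have h := Real.integral_rpow_mul_exp_neg_mul_Ioi ha (pow_pos hx' 2)
    have he : ∀ t, gaussComponent d t x = t ^ ((d : ℝ) / 2 - 1 - 1) *
        Real.exp (-(‖x‖ ^ 2 * t)) / Real.Gamma ((d : ℝ) / 2 - 1) := by
      intro t
      unfold gaussComponent
      ring_nf
    simp only [he, integral_div, h, ck, if_neg hd2]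
    rw [mul_div_assoc, div_self hΓ.ne', mul_one, one_div, Real.inv_rpow (by positivity),
      ← Real.rpow_natCast, ← Real.rpow_mul hx'.le, ← Real.rpow_neg hx'.le]
    congr 1
    push_cast
    ring
  have hpos : 0 < ck d x := by
    rw [ck, if_neg hd2]
    positivity
  have hi : IntegrableOn (fun t => gaussComponent d t x) (Set.Ioi 0) :=
    Integrable.of_integral_ne_zero (by rw [hint]; exact hpos.ne')
  rw [longRange, shortRange, ← lintegral_union measurableSet_Ioi
    (Set.disjoint_left.2 fun t h1 h2 => not_lt.2 h1.2 h2), Set.Ioc_union_Ioi_eq_Ioi hT, ← hint,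
    ofReal_integral_eq_lintegral_ofReal hi]
  filter_upwards [ae_restrict_mem measurableSet_Ioi] with t ht
  exact gaussComponent_nonneg hd (le_of_lt ht) x

lemma longRange_zero_le {d : ℕ} (hd : 3 ≤ d) {T : ℝ} (hT : 0 ≤ T) :
    longRange d T 0 ≤ ENNReal.ofReal
      (T ^ ((d : ℝ) / 2 - 1) / (((d : ℝ) / 2 - 1) * Real.Gamma ((d : ℝ) / 2 - 1))) := by
  have ha := half_dim_sub_one_pos hd
  have hII : IntervalIntegrable (fun t : ℝ => t ^ ((d : ℝ) / 2 - 2)) volume 0 T :=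
    intervalIntegral.intervalIntegrable_rpow' (by linarith)
  have hi : IntegrableOn (fun t => gaussComponent d t 0) (Set.Ioc 0 T) := by
    simpa [gaussComponent, IntegrableOn] using
      ((intervalIntegrable_iff_integrableOn_Ioc_of_le hT).1 hII).div_const _
  rw [longRange, ← ofReal_integral_eq_lintegral_ofReal hi]
  · refine ENNReal.ofReal_le_ofReal (le_of_eq ?_)
    rw [← intervalIntegral.integral_of_le hT]
    simp only [gaussComponent, norm_zero, ne_eq, OfNat.ofNat_ne_zero, not_false_eq_true, zero_pow,
      mul_zero, Real.exp_zero, mul_one, intervalIntegral.integral_div]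
    rw [integral_rpow (Or.inl (by linarith)), show (d : ℝ) / 2 - 2 + 1 = (d : ℝ) / 2 - 1 by ring,
      Real.zero_rpow ha.ne', sub_zero, div_div]
  · filter_upwards [ae_restrict_mem measurableSet_Ioc] with t ht
    exact gaussComponent_nonneg hd ht.1.le _

lemma lintegral_exp_neg_mul_sq_norm {d : ℕ} {b : ℝ} (hb : 0 < b) :
    ∫⁻ x : Euc d, ENNReal.ofReal (Real.exp (-b * ‖x‖ ^ 2))
      = ENNReal.ofReal ((Real.pi / b) ^ ((d : ℝ) / 2)) := by
  have h := GaussianFourier.integral_rexp_neg_mul_sq_norm (V := Euc d) hb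
  rw [finrank_euclideanSpace_fin] at h
  rw [← h, ofReal_integral_eq_lintegral_ofReal]
  · exact Integrable.of_integral_ne_zero (by rw [h]; positivity)
  · exact ae_of_all _ fun x => (Real.exp_pos _).le

lemma lintegral_shortRange_le {d : ℕ} (hd : 3 ≤ d) {T : ℝ} (hT : 0 < T) :
    ∫⁻ x : Euc d, shortRange d T x ≤
      ENNReal.ofReal (Real.pi ^ ((d : ℝ) / 2) / Real.Gamma ((d : ℝ) / 2 - 1) / T) := by
  have hΓ := Real.Gamma_pos_of_pos (half_dim_sub_one_pos hd)
  set c := Real.pi ^ ((d : ℝ) / 2) / Real.Gamma ((d : ℝ) / 2 - 1) with hc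
  have hc0 : 0 ≤ c := by positivity
  have hslice : ∀ t ∈ Set.Ioi T, ∫⁻ x : Euc d, ENNReal.ofReal (gaussComponent d t x)
      = ENNReal.ofReal (c * t ^ (-2 : ℝ)) := by
    intro t ht
    have ht0 : 0 < t := hT.trans ht
    have he : ∀ x : Euc d, ENNReal.ofReal (gaussComponent d t x)
        = ENNReal.ofReal (t ^ ((d : ℝ) / 2 - 2) / Real.Gamma ((d : ℝ) / 2 - 1)) *
          ENNReal.ofReal (Real.exp (-t * ‖x‖ ^ 2)) := by
      intro x
      rw [← ENNReal.ofReal_mul (by positivity), gaussComponent]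
      ring_nf
    simp only [he]
    rw [lintegral_const_mul _ (by fun_prop), lintegral_exp_neg_mul_sq_norm ht0,
      ← ENNReal.ofReal_mul (by positivity), hc, Real.div_rpow Real.pi_pos.le ht0.le,
      show (-2 : ℝ) = ((d : ℝ) / 2 - 2) - (d : ℝ) / 2 by ring, Real.rpow_sub ht0 ((d : ℝ) / 2 - 2)]
    congr 1
    ring
  have hi : IntegrableOn (fun t : ℝ => c * t ^ (-2 : ℝ)) (Set.Ioi T) :=
    (integrableOn_Ioi_rpow_of_lt (by norm_num) hT).const_mul c
  unfold shortRange
  rw [lintegral_lintegral_swap, setLIntegral_congr_fun measurableSet_Ioi hslice,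
    ← ofReal_integral_eq_lintegral_ofReal hi]
  · refine ENNReal.ofReal_le_ofReal (le_of_eq ?_)
    rw [integral_const_mul, integral_Ioi_rpow_of_lt (by norm_num) hT]
    norm_num [Real.rpow_neg_one]
    rfl
  · filter_upwards [ae_restrict_mem measurableSet_Ioi] with t ht
    have : 0 < t := hT.trans ht
    show 0 ≤ c * t ^ (-2 : ℝ)
    positivity
  · exact ((measurable_gaussComponent d).comp measurable_swap).ennreal_ofReal.aemeasurable

lemma sq_norm_sub_add_sq_norm_sub {E : Type*} [NormedAddCommGroup E] [InnerProductSpace ℝ E]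
    (x y z : E) : 2 * ‖x - z‖ ^ 2 + 2 * ‖y - z‖ ^ 2
      = ‖x - y‖ ^ 2 + 4 * ‖z - (1 / 2 : ℝ) • (x + y)‖ ^ 2 := by
  have h1 := parallelogram_law_with_norm ℝ (x - z) (y - z)
  have h2 : x - z + (y - z) = (-2 : ℝ) • (z - (1 / 2 : ℝ) • (x + y)) := by module
  rw [sub_sub_sub_cancel_right, h2, norm_smul] at h1
  norm_num at h1 ⊢
  nlinarith

/-- The square root, in the sense of composition of kernels, of `gaussComponent`. -/
def gaussFactor (d : ℕ) (p : ℝ × Euc d) (x : Euc d) : ℝ≥0∞ :=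
  ENNReal.ofReal (√(p.1 ^ ((d : ℝ) / 2 - 2) / Real.Gamma ((d : ℝ) / 2 - 1) *
    (4 * p.1 / Real.pi) ^ ((d : ℝ) / 2)) * Real.exp (-(2 * p.1) * ‖x - p.2‖ ^ 2))

lemma measurable_gaussFactor (d : ℕ) : Measurable (Function.uncurry (gaussFactor d)) := by
  unfold gaussFactor Function.uncurry
  fun_prop

lemma longRange_sub_eq_lintegral {d : ℕ} (hd : 3 ≤ d) (T : ℝ) (x y : Euc d) :
    longRange d T (x - y) = ∫⁻ p, gaussFactor d p x * gaussFactor d p y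
      ∂((volume.restrict (Set.Ioc 0 T)).prod volume) := by
  have hΓ := Real.Gamma_pos_of_pos (half_dim_sub_one_pos hd)
  have hm : ∀ x, Measurable fun p => gaussFactor d p x :=
    fun x => (measurable_gaussFactor d).comp measurable_prodMk_right
  rw [lintegral_prod _ (by fun_prop), longRange]
  refine setLIntegral_congr_fun measurableSet_Ioc fun t ht => ?_
  have ht0 : 0 < t := ht.1
  set a := t ^ ((d : ℝ) / 2 - 2) / Real.Gamma ((d : ℝ) / 2 - 1) with ha
  set b := (4 * t / Real.pi) ^ ((d : ℝ) / 2) with hb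
  have ha0 : 0 ≤ a := by positivity
  have hb0 : 0 < b := by positivity
  have he : ∀ z : Euc d, gaussFactor d (t, z) x * gaussFactor d (t, z) y =
      ENNReal.ofReal (a * b * Real.exp (-t * ‖x - y‖ ^ 2)) *
        ENNReal.ofReal (Real.exp (-(4 * t) * ‖z - (1 / 2 : ℝ) • (x + y)‖ ^ 2)) := by
    intro z
    simp only [gaussFactor]
    rw [← ENNReal.ofReal_mul (by positivity), ← ENNReal.ofReal_mul (by positivity),
      mul_mul_mul_comm, Real.mul_self_sqrt (by positivity), mul_assoc (a * b), ← Real.exp_add,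
      ← Real.exp_add]
    congr 3
    linear_combination (-t) * sq_norm_sub_add_sq_norm_sub x y z
  simp only [he]
  rw [lintegral_const_mul _ (by fun_prop),
    lintegral_sub_right_eq_self (fun z : Euc d => ENNReal.ofReal (Real.exp (-(4 * t) * ‖z‖ ^ 2))),
    lintegral_exp_neg_mul_sq_norm (by positivity), ← ENNReal.ofReal_mul (by positivity)]
  congr 1
  have hbb : b * (Real.pi / (4 * t)) ^ ((d : ℝ) / 2) = 1 := by
    rw [hb, ← Real.mul_rpow (by positivity) (by positivity)]
    convert Real.one_rpow _ using 2
    field_simp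
  rw [gaussComponent, mul_div_right_comm, ← ha]
  linear_combination -(a * Real.exp (-t * ‖x - y‖ ^ 2)) * hbb

lemma two_mul_lintegral_longRange_le {d : ℕ} (hd : 3 ≤ d) (T : ℝ) (σ τ : Measure (Euc d))
    [SFinite σ] [SFinite τ] :
    2 * ∫⁻ x, ∫⁻ y, longRange d T (x - y) ∂τ ∂σ
      ≤ ∫⁻ x, ∫⁻ y, longRange d T (x - y) ∂σ ∂σ + ∫⁻ x, ∫⁻ y, longRange d T (x - y) ∂τ ∂τ := by
  simp only [longRange_sub_eq_lintegral hd]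
  exact two_mul_lintegral_factored_kernel_le _ σ τ (measurable_gaussFactor d)

end GaussianDecomposition

section LowerBound

lemma ck_nonneg {d : ℕ} (hd : 3 ≤ d) (x : Euc d) : 0 ≤ ck d x := by
  rw [ck, if_neg (by omega)]
  positivity

lemma measurable_ck (d : ℕ) : Measurable (ck d) := by
  unfold ck
  split_ifs <;> fun_prop

lemma measurable_longRange (d : ℕ) (T : ℝ) : Measurable (longRange d T) :=
  ((measurable_gaussComponent d).comp measurable_swap).ennreal_ofReal.lintegral_prod_right'

lemma measurable_shortRange (d : ℕ) (T : ℝ) : Measurable (shortRange d T) :=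
  ((measurable_gaussComponent d).comp measurable_swap).ennreal_ofReal.lintegral_prod_right'

lemma longRange_le_ofReal_ck {d : ℕ} (hd : 3 ≤ d) {T : ℝ} (hT : 0 ≤ T) {x : Euc d}
    (hx : x ≠ 0) : longRange d T x ≤ ENNReal.ofReal (ck d x) :=
  longRange_add_shortRange hd hT hx ▸ le_self_add

lemma ofReal_ck_le_add {d : ℕ} (hd : 3 ≤ d) {T : ℝ} (hT : 0 ≤ T) (x : Euc d) :
    ENNReal.ofReal (ck d x) ≤ longRange d T x + shortRange d T x := by
  rcases eq_or_ne x 0 with rfl | hx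
  · have : (d : ℝ) ≠ 2 := by exact_mod_cast (by omega : d ≠ 2)
    rw [ck, if_neg (by omega), norm_zero, Real.zero_rpow (sub_ne_zero.2 this.symm)]
    simp
  · exact (longRange_add_shortRange hd hT hx).ge

/-- The sum of all pair interactions `Σ_{i≠j} w(x_i − x_j)`. -/
def pairSum (d : ℕ) {n : ℕ} (x : Fin n → Euc d) : ℝ :=
  ∑ i : Fin n, ∑ j : Fin n, if i ≠ j then ck d (x i - x j) else 0

/-- The Coulomb energy of `Σ δ_{x_i} − n ν` with the self-interactions of the points removed. -/
def fluctEnergy (d : ℕ) (ν : Measure (Euc d)) {n : ℕ} (x : Fin n → Euc d) : ℝ :=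
  pairSum d x - 2 * n * ∑ i, ∫ y, ck d (x i - y) ∂ν
    + (n : ℝ) ^ 2 * ∫ z : Euc d × Euc d, ck d (z.1 - z.2) ∂(ν.prod ν)

lemma ofReal_integral_ck_sub_le {d : ℕ} (hd : 3 ≤ d) {T : ℝ} (hT : 0 < T) {ν : Measure (Euc d)}
    {C₀ : ℝ} (hν : ν ≤ ENNReal.ofReal C₀ • volume) {p : Euc d}
    (hi : Integrable (fun y => ck d (p - y)) ν) :
    ENNReal.ofReal (∫ y, ck d (p - y) ∂ν) ≤ ∫⁻ y, longRange d T (p - y) ∂ν +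
      ENNReal.ofReal C₀ * ENNReal.ofReal
        (Real.pi ^ ((d : ℝ) / 2) / Real.Gamma ((d : ℝ) / 2 - 1) / T) := by
  rw [ofReal_integral_eq_lintegral_ofReal hi (ae_of_all _ fun y => ck_nonneg hd _)]
  have hL := measurable_longRange d T
  refine (lintegral_mono fun y => ofReal_ck_le_add hd hT.le (p - y)).trans ?_
  rw [lintegral_add_left (by fun_prop)]
  gcongr
  calc ∫⁻ y, shortRange d T (p - y) ∂ν
      ≤ ∫⁻ y, shortRange d T (p - y) ∂(ENNReal.ofReal C₀ • volume) := lintegral_mono' hν le_rfl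
    _ = ENNReal.ofReal C₀ * ∫⁻ y, shortRange d T y := by
        rw [lintegral_smul_measure, lintegral_sub_left_eq_self (shortRange d T) p, smul_eq_mul]
    _ ≤ _ := by
        gcongr
        exact lintegral_shortRange_le hd hT

lemma lintegral_longRange_le_integral_ck {d : ℕ} (hd : 3 ≤ d) {T : ℝ} (hT : 0 ≤ T)
    (ν : Measure (Euc d)) [SFinite ν] [NullSingletonClass ν]
    (hi : Integrable (fun z : Euc d × Euc d => ck d (z.1 - z.2)) (ν.prod ν)) :
    ∫⁻ x, ∫⁻ y, longRange d T (x - y) ∂ν ∂ν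
      ≤ ENNReal.ofReal (∫ z : Euc d × Euc d, ck d (z.1 - z.2) ∂(ν.prod ν)) := by
  have hm := measurable_ck d
  rw [ofReal_integral_eq_lintegral_ofReal hi (ae_of_all _ fun y => ck_nonneg hd _),
    lintegral_prod _ (by fun_prop)]
  refine lintegral_mono fun x => lintegral_mono_ae ?_
  filter_upwards [ν.ae_ne x] with y hy
  exact longRange_le_ofReal_ck hd hT (sub_ne_zero.2 hy.symm)

lemma sum_longRange_le {d : ℕ} (hd : 3 ≤ d) {T : ℝ} (hT : 0 ≤ T) {n : ℕ} {x : Fin n → Euc d}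
    (hx : Function.Injective x) :
    ∑ i, ∑ j, longRange d T (x i - x j)
      ≤ ENNReal.ofReal (pairSum d x) + n * longRange d T 0 := by
  have hnn : ∀ i j, 0 ≤ if i ≠ j then ck d (x i - x j) else 0 := fun i j => by
    split_ifs
    exacts [ck_nonneg hd _, le_rfl]
  have hdiag : (n : ℝ≥0∞) * longRange d T 0 =
      ∑ i : Fin n, ∑ j : Fin n, if i = j then longRange d T 0 else 0 := by simp
  rw [pairSum, ENNReal.ofReal_sum_of_nonneg fun i _ => Finset.sum_nonneg fun j _ => hnn i j, hdiag,
    ← Finset.sum_add_distrib]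
  refine Finset.sum_le_sum fun i _ => ?_
  rw [ENNReal.ofReal_sum_of_nonneg fun j _ => hnn i j, ← Finset.sum_add_distrib]
  refine Finset.sum_le_sum fun j _ => ?_
  rcases eq_or_ne i j with rfl | hij
  · simp
  · simpa [hij] using longRange_le_ofReal_ck hd hT (sub_ne_zero.2 (hx.ne hij))

/-- Lower bound on the energy of a configuration of distinct points. -/
lemma neg_le_fluctEnergy {d : ℕ} (hd : 3 ≤ d) {T : ℝ} (hT : 0 < T) {ν : Measure (Euc d)}
    [IsProbabilityMeasure ν] [NullSingletonClass ν] {C₀ : ℝ} (hC₀ : 0 ≤ C₀)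
    (hν : ν ≤ ENNReal.ofReal C₀ • volume)
    (hi : ∀ p : Euc d, Integrable (fun y => ck d (p - y)) ν)
    (hi₂ : Integrable (fun z : Euc d × Euc d => ck d (z.1 - z.2)) (ν.prod ν))
    {n : ℕ} {x : Fin n → Euc d} (hx : Function.Injective x) :
    -(n * (T ^ ((d : ℝ) / 2 - 1) / (((d : ℝ) / 2 - 1) * Real.Gamma ((d : ℝ) / 2 - 1)))
      + 2 * (n : ℝ) ^ 2 * (C₀ * (Real.pi ^ ((d : ℝ) / 2) / Real.Gamma ((d : ℝ) / 2 - 1) / T)))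
      ≤ fluctEnergy d ν x := by
  have ha := half_dim_sub_one_pos hd
  have hΓ := Real.Gamma_pos_of_pos ha
  have hk : ∀ σ : Measure (Euc d), ∀ c : ℝ≥0∞, ∀ x : Euc d, ∫⁻ y, longRange d T (x - y) ∂(c • σ)
      = c * ∫⁻ y, longRange d T (x - y) ∂σ := fun σ c x => by
    rw [lintegral_smul_measure, smul_eq_mul]
  have hL := measurable_longRange d T
  have hLν : Measurable fun x => ∫⁻ y, longRange d T (x - y) ∂ν :=
    Measurable.lintegral_prod_right' (f := fun z : Euc d × Euc d => longRange d T (z.1 - z.2))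
      (by fun_prop)
  have hpos := two_mul_lintegral_longRange_le hd T (∑ i, Measure.dirac (x i))
    ((n : ℝ≥0∞) • ν)
  simp only [lintegral_finsetSum_measure, hk, lintegral_smul_measure, smul_eq_mul,
    lintegral_const_mul _ hLν] at hpos
  simp only [lintegral_dirac] at hpos
  set k₀ := T ^ ((d : ℝ) / 2 - 1) / (((d : ℝ) / 2 - 1) * Real.Gamma ((d : ℝ) / 2 - 1)) with hk₀
  set s := Real.pi ^ ((d : ℝ) / 2) / Real.Gamma ((d : ℝ) / 2 - 1) / T with hs
  set D := ∫ z : Euc d × Euc d, ck d (z.1 - z.2) ∂(ν.prod ν) with hD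
  have hk₀0 : 0 ≤ k₀ := by positivity
  have hs0 : 0 ≤ s := by positivity
  have hD0 : 0 ≤ D := integral_nonneg fun z => ck_nonneg hd _
  have hh0 : ∀ i, 0 ≤ ∫ y, ck d (x i - y) ∂ν := fun i => integral_nonneg fun y => ck_nonneg hd _
  have hp0 : 0 ≤ pairSum d x := Finset.sum_nonneg fun i _ => Finset.sum_nonneg fun j _ => by
    split_ifs
    exacts [ck_nonneg hd _, le_rfl]
  have key : ENNReal.ofReal (2 * (n * ∑ i, ∫ y, ck d (x i - y) ∂ν)) ≤
      ENNReal.ofReal (pairSum d x + n * k₀ + n * (n * D) + 2 * (n * (n * (C₀ * s)))) := by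
    calc ENNReal.ofReal (2 * (n * ∑ i, ∫ y, ck d (x i - y) ∂ν))
        = 2 * (n * ∑ i, ENNReal.ofReal (∫ y, ck d (x i - y) ∂ν)) := by
          rw [ENNReal.ofReal_mul (by positivity), ENNReal.ofReal_mul (by positivity),
            ENNReal.ofReal_sum_of_nonneg fun i _ => hh0 i, ENNReal.ofReal_natCast,
            ENNReal.ofReal_ofNat]
      _ ≤ 2 * (n * ∑ i, (∫⁻ y, longRange d T (x i - y) ∂ν +
            ENNReal.ofReal C₀ * ENNReal.ofReal s)) := by
          gcongr with i
          exact ofReal_integral_ck_sub_le hd hT hν (hi _)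
      _ = 2 * (n * ∑ i, ∫⁻ y, longRange d T (x i - y) ∂ν)
            + 2 * (n * (n * (ENNReal.ofReal C₀ * ENNReal.ofReal s))) := by
          simp only [Finset.sum_add_distrib, Finset.sum_const, Finset.card_univ, Fintype.card_fin,
            nsmul_eq_mul, mul_add]
      _ ≤ (ENNReal.ofReal (pairSum d x) + n * ENNReal.ofReal k₀ + n * (n * ENNReal.ofReal D))
            + 2 * (n * (n * (ENNReal.ofReal C₀ * ENNReal.ofReal s))) := by
          gcongr
          refine hpos.trans ?_
          gcongr
          · refine (sum_longRange_le hd hT.le hx).trans ?_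
            gcongr
            exact longRange_zero_le hd hT.le
          · exact lintegral_longRange_le_integral_ck hd hT.le ν hi₂
      _ = _ := by
          rw [ENNReal.ofReal_add (by positivity) (by positivity),
            ENNReal.ofReal_add (by positivity) (by positivity),
            ENNReal.ofReal_add (by positivity) (by positivity)]
          simp only [ENNReal.ofReal_mul (Nat.cast_nonneg n), ENNReal.ofReal_mul zero_le_two,
            ENNReal.ofReal_mul hC₀, ENNReal.ofReal_natCast, ENNReal.ofReal_ofNat]
  rw [ENNReal.ofReal_le_ofReal_iff (by positivity)] at key
  rw [fluctEnergy]
  linarith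

end LowerBound

section ProductMeasure

variable {d : ℕ} {ν : Measure (Euc d)} [IsProbabilityMeasure ν] {n : ℕ}

lemma measurePreserving_eval_pair {ι X : Type*} [Fintype ι] [MeasurableSpace X] (ν : Measure X)
    [IsProbabilityMeasure ν] {i j : ι} (hij : i ≠ j) :
    MeasurePreserving (fun x : ι → X => (x i, x j)) (Measure.pi fun _ => ν) (ν.prod ν) := by
  refine ⟨by fun_prop, ?_⟩
  have h := (ProbabilityTheory.iIndepFun_pi (μ := fun _ : ι => ν) (X := fun _ => id)
    fun _ => aemeasurable_id).indepFun hij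
  have h' := h.map_prod_eq_prod_map_map (measurable_pi_apply i).aemeasurable
    (measurable_pi_apply j).aemeasurable
  have he : ∀ i : ι, Measure.map (fun x : ι → X => x i) (Measure.pi fun _ => ν) = ν :=
    fun i => (measurePreserving_eval (fun _ : ι => ν) i).map_eq
  simpa only [id, he] using h'

lemma integrable_integral_ck_sub
    (hi₂ : Integrable (fun z : Euc d × Euc d => ck d (z.1 - z.2)) (ν.prod ν)) (i : Fin n) :
    Integrable (fun x : Fin n → Euc d => ∫ y, ck d (x i - y) ∂ν) (Measure.pi fun _ => ν) :=
  (measurePreserving_eval (fun _ : Fin n => ν) i).integrable_comp_of_integrable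
    hi₂.integral_prod_left

lemma integral_integral_ck_sub
    (hi₂ : Integrable (fun z : Euc d × Euc d => ck d (z.1 - z.2)) (ν.prod ν)) (i : Fin n) :
    ∫ x : Fin n → Euc d, (∫ y, ck d (x i - y) ∂ν) ∂(Measure.pi fun _ => ν)
      = ∫ z : Euc d × Euc d, ck d (z.1 - z.2) ∂(ν.prod ν) := by
  have h := (measurePreserving_eval (fun _ : Fin n => ν) i).map_eq
  have hm : AEStronglyMeasurable (fun u => ∫ y, ck d (u - y) ∂ν)
      (Measure.map (Function.eval i) (Measure.pi fun _ : Fin n => ν)) := by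
    rw [h]
    exact hi₂.integral_prod_left.aestronglyMeasurable
  rw [integral_prod _ hi₂]
  exact (integral_map (measurable_pi_apply i).aemeasurable hm).symm.trans (by rw [h])

lemma integrable_pair_ck
    (hi₂ : Integrable (fun z : Euc d × Euc d => ck d (z.1 - z.2)) (ν.prod ν)) (i j : Fin n) :
    Integrable (fun x : Fin n → Euc d => if i ≠ j then ck d (x i - x j) else 0)
      (Measure.pi fun _ => ν) := by
  split_ifs with hij
  · exact (measurePreserving_eval_pair ν hij).integrable_comp_of_integrable hi₂
  · exact integrable_zero _ _ _

lemma integral_pair_ck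
    (hi₂ : Integrable (fun z : Euc d × Euc d => ck d (z.1 - z.2)) (ν.prod ν)) (i j : Fin n) :
    ∫ x : Fin n → Euc d, (if i ≠ j then ck d (x i - x j) else 0) ∂(Measure.pi fun _ => ν)
      = if i ≠ j then ∫ z : Euc d × Euc d, ck d (z.1 - z.2) ∂(ν.prod ν) else 0 := by
  split_ifs with hij
  · have h := (measurePreserving_eval_pair ν hij).map_eq
    rw [← h, integral_map (by fun_prop)]
    rw [h]
    exact hi₂.aestronglyMeasurable
  · simp

lemma integrable_pairSum
    (hi₂ : Integrable (fun z : Euc d × Euc d => ck d (z.1 - z.2)) (ν.prod ν)) :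
    Integrable (fun x : Fin n → Euc d => pairSum d x) (Measure.pi fun _ => ν) :=
  integrable_finsetSum _ fun i _ => integrable_finsetSum _ fun j _ => integrable_pair_ck hi₂ i j

lemma integrable_fluctEnergy
    (hi₂ : Integrable (fun z : Euc d × Euc d => ck d (z.1 - z.2)) (ν.prod ν)) :
    Integrable (fun x : Fin n → Euc d => fluctEnergy d ν x) (Measure.pi fun _ => ν) :=
  ((integrable_pairSum hi₂).sub ((integrable_finsetSum _ fun i _ =>
    integrable_integral_ck_sub hi₂ i).const_mul _)).add (integrable_const _)

lemma integral_fluctEnergy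
    (hi₂ : Integrable (fun z : Euc d × Euc d => ck d (z.1 - z.2)) (ν.prod ν)) :
    ∫ x : Fin n → Euc d, fluctEnergy d ν x ∂(Measure.pi fun _ => ν)
      = -(n * ∫ z : Euc d × Euc d, ck d (z.1 - z.2) ∂(ν.prod ν)) := by
  set D := ∫ z : Euc d × Euc d, ck d (z.1 - z.2) ∂(ν.prod ν) with hD
  have h1 : ∫ x : Fin n → Euc d, pairSum d x ∂(Measure.pi fun _ => ν) = n * (n * D) - n * D := by
    unfold pairSum
    rw [integral_finsetSum _ fun i _ => integrable_finsetSum _ fun j _ => integrable_pair_ck hi₂ i j]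
    have : ∀ i j : Fin n, (if i ≠ j then D else 0) = D - if i = j then D else 0 := by
      intro i j
      split_ifs <;> simp_all
    simp_rw [integral_finsetSum _ fun j _ => integrable_pair_ck hi₂ _ j, integral_pair_ck hi₂,
      ← hD, this]
    simp [Finset.sum_sub_distrib]
  have h2 : ∫ x : Fin n → Euc d, ∑ i, ∫ y, ck d (x i - y) ∂ν ∂(Measure.pi fun _ => ν)
      = n * D := by
    rw [integral_finsetSum _ fun i _ => integrable_integral_ck_sub hi₂ i]
    simp [integral_integral_ck_sub hi₂, hD]
  have hI2 : Integrable (fun x : Fin n → Euc d => 2 * (n : ℝ) * ∑ i, ∫ y, ck d (x i - y) ∂ν)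
      (Measure.pi fun _ => ν) :=
    (integrable_finsetSum _ fun i _ => integrable_integral_ck_sub hi₂ i).const_mul _
  unfold fluctEnergy
  rw [integral_add (by exact (integrable_pairSum hi₂).sub hI2) (integrable_const _),
    integral_sub (integrable_pairSum hi₂) hI2, integral_const_mul, h1, h2, integral_const]
  simp
  ring

lemma ae_injective_pi [NullSingletonClass ν] :
    ∀ᵐ x : Fin n → Euc d ∂(Measure.pi fun _ => ν), Function.Injective x := by
  have h : ∀ i j : Fin n, i ≠ j → ∀ᵐ x : Fin n → Euc d ∂(Measure.pi fun _ => ν), x i ≠ x j := by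
    intro i j hij
    have hp := measurePreserving_eval_pair ν hij
    refine hp.quasiMeasurePreserving.ae (p := fun z => z.1 ≠ z.2) ?_
    have hms : MeasurableSet {z : Euc d × Euc d | z.1 ≠ z.2} :=
      (measurableSet_eq_fun measurable_fst measurable_snd).compl
    rw [Measure.ae_prod_iff_ae_ae hms]
    exact ae_of_all _ fun x => (ν.ae_ne x).mono fun y hy => hy.symm
  have h' : ∀ᵐ x : Fin n → Euc d ∂(Measure.pi fun _ => ν), ∀ i j : Fin n, i ≠ j → x i ≠ x j := by
    simpa only [eventually_all] using h
  filter_upwards [h'] with x hx i j hij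
  by_contra hne
  exact hx i j hne hij

/-- The normalized partition function is bounded from both sides, by `exp u ≥ 1 + u` and by a
pointwise lower bound on the energy. -/
lemma integral_exp_fluctEnergy_bounds (hd : 3 ≤ d) [NullSingletonClass ν] {β B : ℝ} (hβ : 0 ≤ β)
    (hi₂ : Integrable (fun z : Euc d × Euc d => ck d (z.1 - z.2)) (ν.prod ν))
    (hB : ∀ x : Fin n → Euc d, Function.Injective x → -B ≤ fluctEnergy d ν x) :
    1 ≤ ∫ x : Fin n → Euc d, Real.exp (-(β / 2) * fluctEnergy d ν x) ∂(Measure.pi fun _ => ν) ∧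
    ∫ x : Fin n → Euc d, Real.exp (-(β / 2) * fluctEnergy d ν x) ∂(Measure.pi fun _ => ν)
      ≤ Real.exp (β / 2 * B) := by
  have hW := integrable_fluctEnergy (n := n) hi₂
  have hle : ∀ᵐ x : Fin n → Euc d ∂(Measure.pi fun _ => ν),
      Real.exp (-(β / 2) * fluctEnergy d ν x) ≤ Real.exp (β / 2 * B) := by
    filter_upwards [ae_injective_pi] with x hx
    have := hB x hx
    refine Real.exp_le_exp.2 ?_
    nlinarith
  have hE : Integrable (fun x : Fin n → Euc d => Real.exp (-(β / 2) * fluctEnergy d ν x))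
      (Measure.pi fun _ => ν) := by
    refine (integrable_const (Real.exp (β / 2 * B))).mono'
      (Real.continuous_exp.comp_aestronglyMeasurable (hW.const_mul _).aestronglyMeasurable) ?_
    filter_upwards [hle] with x hx
    rwa [Real.norm_of_nonneg (Real.exp_pos _).le]
  constructor
  · have hD0 : 0 ≤ ∫ z : Euc d × Euc d, ck d (z.1 - z.2) ∂(ν.prod ν) :=
      integral_nonneg fun z => ck_nonneg hd _
    calc (1 : ℝ) ≤ ∫ x : Fin n → Euc d, (-(β / 2) * fluctEnergy d ν x + 1)
          ∂(Measure.pi fun _ => ν) := by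
          rw [integral_add (hW.const_mul _) (integrable_const _), integral_const_mul,
            integral_fluctEnergy hi₂]
          simp only [integral_const, probReal_univ, smul_eq_mul, mul_one, neg_mul_neg]
          have : 0 ≤ β / 2 * (n * ∫ z : Euc d × Euc d, ck d (z.1 - z.2) ∂(ν.prod ν)) := by
            positivity
          linarith
      _ ≤ _ := integral_mono ((hW.const_mul _).add (integrable_const _)) hE
          fun x => Real.add_one_le_exp _
  · calc _ ≤ ∫ _ : Fin n → Euc d, Real.exp (β / 2 * B) ∂(Measure.pi fun _ => ν) :=
          integral_mono_ae hE (integrable_const _) hle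
      _ = _ := by simp

end ProductMeasure

section Density

lemma pi_withDensity_ofReal {ι X : Type*} [Fintype ι] [MeasurableSpace X] {m : Measure X}
    [SigmaFinite m] {f : X → ℝ} (hf : Integrable f m) (hf0 : ∀ x, 0 ≤ f x) :
    Measure.pi (fun _ : ι => m.withDensity fun x => ENNReal.ofReal (f x))
      = (Measure.pi fun _ : ι => m).withDensity fun x => ENNReal.ofReal (∏ i, f (x i)) := by
  have := isFiniteMeasure_withDensity_ofReal hf.2
  refine Measure.pi_eq fun s hs => ?_
  rw [withDensity_apply _ (MeasurableSet.univ_pi hs), Measure.restrict_pi_pi,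
    ← ofReal_integral_eq_lintegral_ofReal, integral_fintype_prod_eq_prod fun _ => f,
    ENNReal.ofReal_prod_of_nonneg fun i _ => integral_nonneg hf0]
  · refine Finset.prod_congr rfl fun i _ => ?_
    rw [withDensity_apply _ (hs i), ofReal_integral_eq_lintegral_ofReal hf.restrict
      (ae_of_all _ hf0)]
  · exact Integrable.fintype_prod fun _ => hf.restrict
  · exact ae_of_all _ fun x => Finset.prod_nonneg fun i _ => hf0 _

lemma integral_withDensity_ofReal {X : Type*} [MeasurableSpace X] {m : Measure X} {f : X → ℝ}
    (hf : Measurable f) (hf0 : ∀ x, 0 ≤ f x) (g : X → ℝ) :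
    ∫ x, g x ∂(m.withDensity fun x => ENNReal.ofReal (f x)) = ∫ x, g x * f x ∂m := by
  rw [integral_withDensity_eq_integral_toReal_smul hf.ennreal_ofReal (by simp)]
  simp only [ENNReal.toReal_ofReal (hf0 _), smul_eq_mul, mul_comm]

lemma integrable_withDensity_ofReal_iff {X : Type*} [MeasurableSpace X] {m : Measure X}
    {f : X → ℝ} (hf : Measurable f) (hf0 : ∀ x, 0 ≤ f x) (g : X → ℝ) :
    Integrable g (m.withDensity fun x => ENNReal.ofReal (f x))
      ↔ Integrable (fun x => g x * f x) m := by
  rw [integrable_withDensity_iff_integrable_smul' hf.ennreal_ofReal (by simp)]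
  simp only [ENNReal.toReal_ofReal (hf0 _), smul_eq_mul, mul_comm]

lemma prod_withDensity_ofReal {X : Type*} [MeasurableSpace X] {m : Measure X} [SigmaFinite m]
    {f : X → ℝ} (hf : Measurable f) (hf0 : ∀ x, 0 ≤ f x) :
    (m.withDensity fun x => ENNReal.ofReal (f x)).prod
        (m.withDensity fun x => ENNReal.ofReal (f x))
      = (m.prod m).withDensity fun z => ENNReal.ofReal (f z.1 * f z.2) := by
  rw [prod_withDensity hf.ennreal_ofReal hf.ennreal_ofReal]
  simp only [ENNReal.ofReal_mul (hf0 _)]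

end Density

section Splitting

variable {d : ℕ} {V : Euc d → ℝ} {n : ℕ} {β : ℝ} {μβ : Euc d → ℝ}

lemma integral_prod_ck_eq_coulombPair (hμ : Measurable μβ) (hμ0 : ∀ x, 0 < μβ x) :
    ∫ z : Euc d × Euc d, ck d (z.1 - z.2)
      ∂((volume.withDensity fun x => ENNReal.ofReal (μβ x)).prod
        (volume.withDensity fun x => ENNReal.ofReal (μβ x))) = coulombPair d μβ μβ := by
  rw [prod_withDensity_ofReal hμ fun x => (hμ0 x).le, integral_withDensity_ofReal (by fun_prop)
    fun z => (mul_pos (hμ0 _) (hμ0 _)).le, coulombPair]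
  simp only [mul_assoc]
  rfl

/-- The variational equation splits the Hamiltonian into its mean-field part, the energy of the
fluctuations, and the logarithm of the density `∏ μβ(x_i)`. -/
lemma coulombHam_eq (hn : 1 ≤ n) (hβ : 0 < β) (hμ : Measurable μβ) (hμ0 : ∀ x, 0 < μβ x)
    (hvar : ∀ x : Euc d, 2 * (∫ y, ck d (x - y) * μβ y) + V x + 2 / (n * β) * Real.log (μβ x) =
      mfFreeEnergy d V n β μβ + coulombPair d μβ μβ) (x : Fin n → Euc d) :
    coulombHam d V n x =
      ((n : ℝ) ^ 2 * mfEnergy d V μβ + 2 * n / β * ∫ x, μβ x * Real.log (μβ x))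
      + fluctEnergy d (volume.withDensity fun x => ENNReal.ofReal (μβ x)) x
      - 2 / β * ∑ i, Real.log (μβ (x i)) := by
  have hn0 : (n : ℝ) ≠ 0 := by positivity
  have hV : ∀ i, (n : ℝ) * V (x i) = n * (mfFreeEnergy d V n β μβ + coulombPair d μβ μβ)
      - 2 * n * (∫ y, ck d (x i - y) * μβ y) - 2 / β * Real.log (μβ (x i)) := by
    intro i
    rw [← hvar (x i)]
    field_simp
    ring
  rw [coulombHam, fluctEnergy, integral_prod_ck_eq_coulombPair hμ hμ0, Finset.mul_sum]
  simp only [hV, integral_withDensity_ofReal hμ fun x => (hμ0 x).le, Finset.sum_sub_distrib,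
    Finset.sum_const, Finset.card_univ, Fintype.card_fin, nsmul_eq_mul, ← Finset.mul_sum, pairSum]
  rw [mfFreeEnergy]
  field_simp
  ring

lemma freeEnergy_eq (hn : 1 ≤ n) (hβ : 0 < β) (hμ : Measurable μβ) (hμ0 : ∀ x, 0 < μβ x)
    (hμi : Integrable μβ)
    (hvar : ∀ x : Euc d, 2 * (∫ y, ck d (x - y) * μβ y) + V x + 2 / (n * β) * Real.log (μβ x) =
      mfFreeEnergy d V n β μβ + coulombPair d μβ μβ)
    (hZ : 0 < ∫ x : Fin n → Euc d, Real.exp (-(β / 2) *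
        fluctEnergy d (volume.withDensity fun x => ENNReal.ofReal (μβ x)) x)
        ∂(Measure.pi fun _ => volume.withDensity fun x => ENNReal.ofReal (μβ x))) :
    freeEnergy d V n β =
      ((n : ℝ) ^ 2 * mfEnergy d V μβ + 2 * n / β * ∫ x, μβ x * Real.log (μβ x))
      - 2 / β * Real.log (∫ x : Fin n → Euc d, Real.exp (-(β / 2) *
        fluctEnergy d (volume.withDensity fun x => ENNReal.ofReal (μβ x)) x)
        ∂(Measure.pi fun _ => volume.withDensity fun x => ENNReal.ofReal (μβ x))) := by
  set A := (n : ℝ) ^ 2 * mfEnergy d V μβ + 2 * n / β * ∫ x, μβ x * Real.log (μβ x) with hA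
  set ν := (volume : Measure (Euc d)).withDensity fun x => ENNReal.ofReal (μβ x) with hν
  have hexp : ∀ x : Fin n → Euc d, Real.exp (-(β / 2) * coulombHam d V n x) =
      Real.exp (-(β / 2) * A) *
        (Real.exp (-(β / 2) * fluctEnergy d ν x) * ∏ i, μβ (x i)) := by
    intro x
    have hprod : ∏ i, μβ (x i) = Real.exp (∑ i, Real.log (μβ (x i))) := by
      rw [Real.exp_sum]
      exact Finset.prod_congr rfl fun i _ => (Real.exp_log (hμ0 _)).symm
    rw [hprod, ← Real.exp_add, ← Real.exp_add, coulombHam_eq hn hβ hμ hμ0 hvar,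
      ← hA, ← hν]
    clear_value A
    congr 1
    field_simp
    ring
  have hint : ∫ x : Fin n → Euc d, Real.exp (-(β / 2) * coulombHam d V n x) =
      Real.exp (-(β / 2) * A) * ∫ x : Fin n → Euc d, Real.exp (-(β / 2) * fluctEnergy d ν x)
        ∂(Measure.pi fun _ => ν) := by
    rw [hν, pi_withDensity_ofReal hμi fun x => (hμ0 x).le, ← hν,
      integral_withDensity_ofReal (by fun_prop)
        fun x => Finset.prod_nonneg fun i _ => (hμ0 (x i)).le, ← integral_const_mul]
    simp only [hexp]
    rfl
  rw [freeEnergy, hint, Real.log_mul (Real.exp_pos _).ne' hZ.ne', Real.log_exp]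
  clear_value A
  field_simp
  ring

end Splitting

/-- **Free energy estimate in the high-temperature regime (`d ≥ 3`).** For a confining
potential `V` with `∫ e^{−β₁V/2} < ∞`, and `c₁ n^{−1} ≤ β ≤ c₂ n^{2/d−1}` with `nβ ≥ β₁`, the
`n`-body free energy satisfies
`|F_{n,β} − n² E[μ_β] − (2n/β) ∫ μ_β log μ_β| ≤ C n^{2−2/d}` for `n` large enough, where `μ_β`
is the positive-temperature mean-field minimizer (characterized by its variational equation),
and `C`, `n₀` depend only on `d`, `ρ`, `c₁`, `c₂`, `C₀` and `β₁`. -/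
theorem free_energy_high_temperature
    (d : ℕ) (hd : 3 ≤ d)
    -- the fixed radial smearing function ρ
    (ρ : Euc d → ℝ) (hρmeas : Measurable ρ) (hρnonneg : ∀ x, 0 ≤ ρ x)
    (hρradial : ∀ x y : Euc d, ‖x‖ = ‖y‖ → ρ x = ρ y)
    (hρsupp : Function.support ρ ⊆ closedBall 0 1)
    (hρint : ∫ x, ρ x = 1)
    (c₁ c₂ C₀ β₁ : ℝ) (hc₁ : 0 < c₁) (hc₂ : 0 < c₂) (hC₀ : 0 < C₀) (hβ₁ : 0 < β₁) :
    ∃ C : ℝ, 0 < C ∧ ∃ n₀ : ℕ,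
      ∀ (V : Euc d → ℝ), Continuous V →
        Tendsto V (Filter.cocompact (Euc d)) Filter.atTop →
        Integrable (fun x => Real.exp (-β₁ * V x / 2)) →
      ∀ (n : ℕ) (β : ℝ), n₀ ≤ n → 1 ≤ n → 0 < β →
        c₁ / n ≤ β → β ≤ c₂ * (n : ℝ) ^ ((2 : ℝ) / d - 1) → β₁ ≤ n * β →
      ∀ (μβ : Euc d → ℝ), Measurable μβ → (∀ x, 0 < μβ x) → (∀ x, μβ x ≤ C₀) →
        (∫ x, μβ x = 1) →
        coulombPair d μβ μβ ≤ C₀ →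
        -- absolute convergence of the Coulomb interactions involved
        Integrable (fun z : Euc d × Euc d => ck d (z.1 - z.2) * μβ z.1 * μβ z.2) →
        (∀ ℓ : ℝ, 0 < ℓ → ∀ p q : Euc d, Integrable
          (fun z : Euc d × Euc d => ck d (z.1 - z.2) * smear d ρ ℓ p z.1 * smear d ρ ℓ q z.2)) →
        (∀ ℓ : ℝ, 0 < ℓ → ∀ p : Euc d, Integrable
          (fun z : Euc d × Euc d => ck d (z.1 - z.2) * μβ z.1 * smear d ρ ℓ p z.2)) →
        (∀ p : Euc d, Integrable (fun y => ck d (p - y) * μβ y)) →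
        -- finiteness of the potential and entropy terms
        Integrable (fun x => V x * μβ x) →
        Integrable (fun x => μβ x * Real.log (μβ x)) →
        -- the mean-field variational equation
        (∀ x : Euc d, 2 * (∫ y, ck d (x - y) * μβ y) + V x + 2 / (n * β) * Real.log (μβ x) =
          mfFreeEnergy d V n β μβ + coulombPair d μβ μβ) →
        |freeEnergy d V n β - (n : ℝ) ^ 2 * mfEnergy d V μβ
            - 2 * n / β * ∫ x, μβ x * Real.log (μβ x)|
          ≤ C * (n : ℝ) ^ ((2 : ℝ) - 2 / d) := by
  have ha := half_dim_sub_one_pos hd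
  have hΓ := Real.Gamma_pos_of_pos ha
  have hd0 : (0 : ℝ) < d := by positivity
  refine ⟨1 / (((d : ℝ) / 2 - 1) * Real.Gamma ((d : ℝ) / 2 - 1))
    + 2 * (C₀ * (Real.pi ^ ((d : ℝ) / 2) / Real.Gamma ((d : ℝ) / 2 - 1))), by positivity, 1, ?_⟩
  intro V _ _ _ n β _ hn hβ _ _ _ μβ hμ hμ0 hμC hμ1 _ hi₂ _ _ hi _ _ hvar
  have hμi : Integrable μβ := integrable_of_integral_eq_one hμ1
  have hμ0' : ∀ x, 0 ≤ μβ x := fun x => (hμ0 x).le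
  set ν := (volume : Measure (Euc d)).withDensity fun x => ENNReal.ofReal (μβ x) with hν
  have : NeZero d := ⟨by omega⟩
  have : IsProbabilityMeasure ν := by
    refine ⟨?_⟩
    rw [hν, withDensity_apply _ MeasurableSet.univ, setLIntegral_univ,
      ← ofReal_integral_eq_lintegral_ofReal hμi (ae_of_all _ hμ0'), hμ1, ENNReal.ofReal_one]
  have hac : ν ≪ volume := withDensity_absolutelyContinuous _ _
  have : NullSingletonClass ν := ⟨fun x => hac (measure_singleton x)⟩
  have hνC : ν ≤ ENNReal.ofReal C₀ • volume := by
    rw [← withDensity_const]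
    exact withDensity_mono (ae_of_all _ fun x => ENNReal.ofReal_le_ofReal (hμC x))
  have hiν : ∀ p : Euc d, Integrable (fun y => ck d (p - y)) ν := fun p =>
    (integrable_withDensity_ofReal_iff hμ hμ0' _).2 (hi p)
  have hi₂ν : Integrable (fun z : Euc d × Euc d => ck d (z.1 - z.2)) (ν.prod ν) := by
    rw [hν, prod_withDensity_ofReal hμ hμ0', integrable_withDensity_ofReal_iff (by fun_prop)
      fun z => mul_nonneg (hμ0' _) (hμ0' _)]
    simpa only [mul_assoc, Measure.volume_eq_prod] using hi₂
  have hn0 : (0 : ℝ) < n := by positivity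
  have hT : (0 : ℝ) < (n : ℝ) ^ ((2 : ℝ) / d) := by positivity
  obtain ⟨hlo, hhi⟩ := integral_exp_fluctEnergy_bounds (n := n) hd hβ.le hi₂ν
    fun x hx => neg_le_fluctEnergy hd hT hC₀.le hνC hiν hi₂ν hx
  set Z := ∫ x : Fin n → Euc d, Real.exp (-(β / 2) * fluctEnergy d ν x)
    ∂(Measure.pi fun _ => ν) with hZ
  have hZ0 : 0 < Z := one_pos.trans_le hlo
  have hlog0 := Real.log_nonneg hlo
  have hlog := (Real.log_le_iff_le_exp hZ0).2 hhi
  have hk : (n : ℝ) * ((n : ℝ) ^ ((2 : ℝ) / d)) ^ ((d : ℝ) / 2 - 1)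
      = (n : ℝ) ^ ((2 : ℝ) - 2 / d) := by
    rw [← Real.rpow_mul hn0.le]
    nth_rewrite 1 [← Real.rpow_one (n : ℝ)]
    rw [← Real.rpow_add hn0]
    congr 1
    field_simp
    ring
  have hs : (n : ℝ) ^ 2 / (n : ℝ) ^ ((2 : ℝ) / d) = (n : ℝ) ^ ((2 : ℝ) - 2 / d) := by
    rw [Real.rpow_sub hn0, Real.rpow_two]
  rw [freeEnergy_eq hn hβ hμ hμ0 hμi hvar hZ0, ← hν, ← hZ]
  rw [show ∀ a b c : ℝ, a + b - c - a - b = -c by intros; ring, abs_neg,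
    abs_of_nonneg (by positivity)]
  calc 2 / β * Real.log Z ≤ 2 / β * (β / 2 * _) := by gcongr
    _ = (n * ((n : ℝ) ^ ((2 : ℝ) / d)) ^ ((d : ℝ) / 2 - 1)) *
          (1 / (((d : ℝ) / 2 - 1) * Real.Gamma ((d : ℝ) / 2 - 1)))
        + ((n : ℝ) ^ 2 / (n : ℝ) ^ ((2 : ℝ) / d)) *
          (2 * (C₀ * (Real.pi ^ ((d : ℝ) / 2) / Real.Gamma ((d : ℝ) / 2 - 1)))) := by
        field_simp
    _ = _ := by
        rw [hk, hs]
        ring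
end
end

section
/- Control of the empirical measure implies control of the first marginal: Let d ≥ 2, n ≥ 1, let μ be a Borel probability measure on (ℝ^d)^n invariant under permutations of the n coordinates, and let μ^{(1)} be its first marginal, i.e. the pushforward of μ under (x_1,…,x_n) ↦ x_1. Let μ_0 be a bounded, compactly supported probability density on ℝ^d, and for x = (x_1,…,x_n) define h_n^x(z) = Σ_{i=1}^n w(z − x_i) − n ∫ w(z − y) μ_0(y) dy. Let 1 ≤ q < d/(d−1) and p = q/(q−1). Then for every φ ∈ C_c^∞(ℝ^d): | ∫_{ℝ^d} φ dμ^{(1)} − ∫_{ℝ^d} φ μ_0 | ≤ (c_d n)^{−1} ‖∇φ‖_{L^p(ℝ^d)} ∫_{(ℝ^d)^n} ‖∇h_n^x‖_{L^q(ℝ^d)} dμ(x), where the right-hand side may be +∞. -/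
open MeasureTheory Metric Real Filter
open scoped Topology ENNReal BigOperators

noncomputable section

/-- The constant `c_d`: `2π` for `d = 2` and `(d−2)|S^{d−1}|` for `d ≥ 3`
(using `|S^{d-1}| = d · |B(0,1)|`). -/
def cConst (d : ℕ) : ℝ :=
  if d = 2 then 2 * π
  else ((d : ℝ) - 2) * d * (volume (ball (0 : Euc d) 1)).toReal

/-- The radial profile of the Coulomb kernel. -/
def coulombProfile (d : ℕ) (r : ℝ) : ℝ :=
  if d = 2 then -Real.log r else r ^ ((2 : ℝ) - d)

/-- The constant `κ` such that the profile has derivative `-κ r^{1-d}`. -/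
def coulombSlope (d : ℕ) : ℝ := if d = 2 then 1 else (d : ℝ) - 2

lemma coulombSlope_pos {d : ℕ} (hd : 2 ≤ d) : 0 < coulombSlope d := by
  unfold coulombSlope
  split_ifs with h
  · exact one_pos
  · have : 2 < d := lt_of_le_of_ne hd (Ne.symm h)
    have : (2 : ℝ) < d := by exact_mod_cast this
    linarith

lemma hasDerivAt_coulombProfile (d : ℕ) {r : ℝ} (hr : 0 < r) :
    HasDerivAt (coulombProfile d) (-coulombSlope d * r ^ ((1 : ℝ) - d)) r := by
  by_cases h : d = 2
  · subst h
    have : HasDerivAt (fun r : ℝ => -Real.log r) (-r⁻¹) r := (Real.hasDerivAt_log hr.ne').neg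
    convert! this using 1
    norm_num [coulombSlope, Real.rpow_neg_one]
  · have := Real.hasDerivAt_rpow_const (x := r) (p := (2 : ℝ) - d) (Or.inl hr.ne')
    have e : coulombProfile d = fun r : ℝ => r ^ ((2 : ℝ) - d) := by
      funext r; simp [coulombProfile, h]
    rw [e]
    convert! this using 1
    simp only [coulombSlope, h, if_false]
    rw [show (2 : ℝ) - d - 1 = 1 - d by ring]
    ring

/-- The regularised Coulomb kernel, obtained by replacing `|x|` by `√(|x|² + ε²)`. -/
def regKernel (d : ℕ) (ε : ℝ) (x : Euc d) : ℝ := coulombProfile d √(‖x‖ ^ 2 + ε ^ 2)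

/-- The gradient of the regularised Coulomb kernel. -/
def regGrad (d : ℕ) (ε : ℝ) (x : Euc d) : Euc d :=
  (-coulombSlope d * √(‖x‖ ^ 2 + ε ^ 2) ^ (-(d : ℝ))) • x

lemma ck_eq_regKernel (d : ℕ) : ck d = regKernel d 0 := by
  funext x
  simp [ck, regKernel, coulombProfile, Real.sqrt_sq (norm_nonneg x)]

lemma hasGradientAt_regKernel (d : ℕ) {ε : ℝ} {x : Euc d} (h : 0 < ‖x‖ ^ 2 + ε ^ 2) :
    HasGradientAt (regKernel d ε) (regGrad d ε x) x := by
  have h1 : HasFDerivAt (fun x : Euc d => ‖x‖ ^ 2 + ε ^ 2) (2 • innerSL ℝ x) x :=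
    ((hasStrictFDerivAt_norm_sq x).hasFDerivAt).add_const _
  have hs : 0 < √(‖x‖ ^ 2 + ε ^ 2) := Real.sqrt_pos.2 h
  have h2 := (hasDerivAt_coulombProfile d hs).comp_hasFDerivAt x (h1.sqrt h.ne')
  rw [hasGradientAt_iff_hasFDerivAt]
  refine HasFDerivAt.congr_fderiv h2 ?_
  ext v
  simp only [regGrad, InnerProductSpace.toDual_apply_apply, inner_smul_left, smul_eq_mul,
    _root_.smul_apply, innerSL_apply_apply, conj_trivial, nsmul_eq_mul]
  rw [show (1 : ℝ) - d = -d + 1 by ring, Real.rpow_add_one hs.ne']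
  push_cast
  field_simp

lemma norm_le_sqrt_add (d : ℕ) (ε : ℝ) (x : Euc d) : ‖x‖ ≤ √(‖x‖ ^ 2 + ε ^ 2) :=
  Real.le_sqrt_of_sq_le (by nlinarith [sq_nonneg ε])

lemma norm_regGrad_le_sqrt {d : ℕ} (hd : 2 ≤ d) (ε : ℝ) (x : Euc d) :
    ‖regGrad d ε x‖ ≤ coulombSlope d * √(‖x‖ ^ 2 + ε ^ 2) ^ ((1 : ℝ) - d) := by
  have hk := (coulombSlope_pos hd).le
  rw [regGrad, norm_smul, norm_mul, norm_neg, Real.norm_of_nonneg hk,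
    Real.norm_of_nonneg (Real.rpow_nonneg (Real.sqrt_nonneg _) _), mul_assoc]
  refine mul_le_mul_of_nonneg_left ?_ hk
  rcases (Real.sqrt_nonneg (‖x‖ ^ 2 + ε ^ 2)).eq_or_lt with h | h
  · have := norm_le_sqrt_add d ε x
    rw [← h] at this
    rw [le_antisymm this (norm_nonneg x), mul_zero]
    exact Real.rpow_nonneg (Real.sqrt_nonneg _) _
  · rw [show (1 : ℝ) - d = -d + 1 by ring, Real.rpow_add_one h.ne']
    exact mul_le_mul_of_nonneg_left (norm_le_sqrt_add d ε x) (Real.rpow_nonneg h.le _)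

lemma one_sub_nat_neg {d : ℕ} (hd : 2 ≤ d) : (1 : ℝ) - d < 0 := by
  have : (2 : ℝ) ≤ d := by exact_mod_cast hd
  linarith

lemma norm_regGrad_le {d : ℕ} (hd : 2 ≤ d) (ε : ℝ) (x : Euc d) :
    ‖regGrad d ε x‖ ≤ coulombSlope d * ‖x‖ ^ ((1 : ℝ) - d) := by
  rcases eq_or_ne x 0 with rfl | hx
  · simp only [regGrad, smul_zero, norm_zero]
    rw [Real.zero_rpow (one_sub_nat_neg hd).ne, mul_zero]
  · exact (norm_regGrad_le_sqrt hd ε x).trans (mul_le_mul_of_nonneg_left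
      (Real.rpow_le_rpow_of_nonpos (norm_pos_iff.2 hx) (norm_le_sqrt_add d ε x)
        (one_sub_nat_neg hd).le) (coulombSlope_pos hd).le)

lemma norm_regGrad_le_const {d : ℕ} (hd : 2 ≤ d) {ε : ℝ} (hε : 0 < ε) (x : Euc d) :
    ‖regGrad d ε x‖ ≤ coulombSlope d * ε ^ ((1 : ℝ) - d) :=
  (norm_regGrad_le_sqrt hd ε x).trans (mul_le_mul_of_nonneg_left
    (Real.rpow_le_rpow_of_nonpos hε (Real.le_sqrt_of_sq_le (by nlinarith [sq_nonneg ‖x‖]))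
      (one_sub_nat_neg hd).le) (coulombSlope_pos hd).le)

lemma abs_regKernel_sub_le {d : ℕ} (hd : 2 ≤ d) {ε : ℝ} (hε : 0 ≤ ε) {x : Euc d} (hx : x ≠ 0) :
    |regKernel d ε x - regKernel d 0 x| ≤ ε * (coulombSlope d * ‖x‖ ^ ((1 : ℝ) - d)) := by
  have hx0 : 0 < ‖x‖ := norm_pos_iff.2 hx
  have hle := norm_le_sqrt_add d ε x
  have hk := (coulombSlope_pos hd).le
  have hc : 0 ≤ coulombSlope d * ‖x‖ ^ ((1 : ℝ) - d) :=
    mul_nonneg hk (Real.rpow_nonneg hx0.le _)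
  have hs : √(‖x‖ ^ 2 + ε ^ 2) ≤ ‖x‖ + ε :=
    Real.sqrt_le_iff.2 ⟨by positivity, by nlinarith [mul_nonneg hx0.le hε]⟩
  have key := norm_image_sub_le_of_norm_deriv_le_segment' (f := coulombProfile d)
    (f' := fun r => -coulombSlope d * r ^ ((1 : ℝ) - d))
    (a := ‖x‖) (b := √(‖x‖ ^ 2 + ε ^ 2)) (C := coulombSlope d * ‖x‖ ^ ((1 : ℝ) - d))
    (fun r hr => (hasDerivAt_coulombProfile d (hx0.trans_le hr.1)).hasDerivWithinAt)
    (fun r hr => by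
      rw [norm_mul, norm_neg, Real.norm_of_nonneg hk,
        Real.norm_of_nonneg (Real.rpow_nonneg (hx0.le.trans hr.1) _)]
      exact mul_le_mul_of_nonneg_left
        (Real.rpow_le_rpow_of_nonpos hx0 hr.1 (one_sub_nat_neg hd).le) hk)
    _ (Set.right_mem_Icc.2 hle)
  have e : regKernel d 0 x = coulombProfile d ‖x‖ := by
    simp [regKernel, Real.sqrt_sq hx0.le]
  rw [e, regKernel, ← Real.norm_eq_abs, mul_comm]
  refine key.trans (mul_le_mul_of_nonneg_left (by linarith) hc)

lemma measurable_coulombProfile (d : ℕ) : Measurable (coulombProfile d) := by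
  unfold coulombProfile
  split_ifs
  · exact Real.measurable_log.neg
  · fun_prop

lemma measurable_regKernel (d : ℕ) (ε : ℝ) : Measurable (regKernel d ε) :=
  (measurable_coulombProfile d).comp (by fun_prop)

lemma measurable_regGrad (d : ℕ) (ε : ℝ) : Measurable (regGrad d ε) := by
  unfold regGrad
  fun_prop

lemma continuous_regKernel (d : ℕ) {ε : ℝ} (hε : ε ≠ 0) : Continuous (regKernel d ε) :=
  continuous_iff_continuousAt.2 fun _ =>
    (hasGradientAt_regKernel d (by positivity)).continuousAt

lemma tendsto_regGrad (d : ℕ) {ε : ℕ → ℝ} (hε : Tendsto ε atTop (𝓝 0)) (x : Euc d) :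
    Tendsto (fun n => regGrad d (ε n) x) atTop (𝓝 (regGrad d 0 x)) := by
  rcases eq_or_ne x 0 with rfl | hx
  · simp [regGrad]
  · have h : Tendsto (fun n => √(‖x‖ ^ 2 + ε n ^ 2)) atTop (𝓝 √(‖x‖ ^ 2 + 0 ^ 2)) :=
      (Real.continuous_sqrt.tendsto _).comp ((hε.pow 2).const_add _)
    have hne : √(‖x‖ ^ 2 + 0 ^ 2) ≠ 0 := by
      have : 0 < ‖x‖ := norm_pos_iff.2 hx
      positivity
    exact ((h.rpow_const (Or.inl hne)).const_mul _).smul_const _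

/-- The function `|x|^{1-d}`, truncated to the ball of radius `R`. -/
def truncPow (d : ℕ) (R : ℝ) : Euc d → ℝ :=
  (ball (0 : Euc d) R).indicator fun x => ‖x‖ ^ ((1 : ℝ) - d)

lemma truncPow_nonneg (d : ℕ) (R : ℝ) (x : Euc d) : 0 ≤ truncPow d R x :=
  Set.indicator_nonneg (fun _ _ => Real.rpow_nonneg (norm_nonneg _) _) x

lemma integrable_truncPow {d : ℕ} (hd : 2 ≤ d) (R : ℝ) : Integrable (truncPow d R) := by
  have : Nonempty (Fin d) := ⟨⟨0, by omega⟩⟩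
  rw [truncPow, integrable_indicator_iff measurableSet_ball,
    integrableOn_fun_norm_addHaar volume (f := fun r : ℝ => r ^ ((1 : ℝ) - d))]
  refine IntegrableOn.congr_fun (f := fun _ => (1 : ℝ)) ?_ ?_ measurableSet_Ioo
  · simp
  · intro r hr
    simp only [finrank_euclideanSpace, Fintype.card_fin, smul_eq_mul]
    rw [← Real.rpow_natCast, ← Real.rpow_add hr.1, Nat.cast_sub (by omega)]
    simp

section Convolution

variable {d : ℕ} {f : Euc d → ℝ} {M ρ : ℝ}

lemma rpow_norm_sub_mul_le (hM : ∀ y, ‖f y‖ ≤ M) (hρ : ∀ y, f y ≠ 0 → ‖y‖ < ρ)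
    {r : ℝ} {z : Euc d} (hz : ‖z‖ < r) (y : Euc d) :
    ‖z - y‖ ^ ((1 : ℝ) - d) * ‖f y‖ ≤ M * truncPow d (r + ρ) (z - y) := by
  have hM0 : 0 ≤ M := (norm_nonneg _).trans (hM 0)
  by_cases h : f y = 0
  · rw [h, norm_zero, mul_zero]
    exact mul_nonneg hM0 (truncPow_nonneg _ _ _)
  · have hmem : z - y ∈ ball (0 : Euc d) (r + ρ) := by
      rw [mem_ball_zero_iff]
      exact (norm_sub_le _ _).trans_lt (add_lt_add hz (hρ y h))
    rw [truncPow, Set.indicator_of_mem hmem, mul_comm]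
    exact mul_le_mul_of_nonneg_right (hM y) (Real.rpow_nonneg (norm_nonneg _) _)

lemma norm_smul_regGrad_le (hd : 2 ≤ d) (hM : ∀ y, ‖f y‖ ≤ M) (hρ : ∀ y, f y ≠ 0 → ‖y‖ < ρ)
    {r : ℝ} {z : Euc d} (hz : ‖z‖ < r) (ε : ℝ) (y : Euc d) :
    ‖f y • regGrad d ε (z - y)‖ ≤ coulombSlope d * (M * truncPow d (r + ρ) (z - y)) := by
  rw [norm_smul]
  calc ‖f y‖ * ‖regGrad d ε (z - y)‖
      ≤ ‖f y‖ * (coulombSlope d * ‖z - y‖ ^ ((1 : ℝ) - d)) :=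
        mul_le_mul_of_nonneg_left (norm_regGrad_le hd _ _) (norm_nonneg _)
    _ = coulombSlope d * (‖z - y‖ ^ ((1 : ℝ) - d) * ‖f y‖) := by ring
    _ ≤ _ := mul_le_mul_of_nonneg_left (rpow_norm_sub_mul_le hM hρ hz y) (coulombSlope_pos hd).le

lemma integrable_truncPow_sub (hd : 2 ≤ d) (R : ℝ) (z : Euc d) :
    Integrable fun y => coulombSlope d * (M * truncPow d R (z - y)) :=
  (((integrable_truncPow hd R).comp_sub_left z).const_mul _).const_mul _

lemma integrable_smul_regGrad (hd : 2 ≤ d) (hf : Measurable f) (hM : ∀ y, ‖f y‖ ≤ M)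
    (hρ : ∀ y, f y ≠ 0 → ‖y‖ < ρ) (ε : ℝ) (z : Euc d) :
    Integrable fun y => f y • regGrad d ε (z - y) :=
  (integrable_truncPow_sub hd (‖z‖ + 1 + ρ) z).mono'
    (hf.smul ((measurable_regGrad d ε).comp (measurable_const.sub measurable_id))
      |>.aestronglyMeasurable)
    (Eventually.of_forall (norm_smul_regGrad_le hd hM hρ (lt_add_one _) ε))

lemma integrable_of_bdd_of_support (hf : Measurable f) (hM : ∀ y, ‖f y‖ ≤ M)
    (hρ : ∀ y, f y ≠ 0 → ‖y‖ < ρ) : Integrable f := by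
  have h : Integrable ((ball (0 : Euc d) ρ).indicator fun _ => M) :=
    (integrable_indicator_iff measurableSet_ball).2
      (integrableOn_const measure_ball_lt_top.ne)
  refine h.mono' hf.aestronglyMeasurable (Eventually.of_forall fun y => ?_)
  by_cases hy : f y = 0
  · rw [hy, norm_zero]
    exact Set.indicator_nonneg (fun _ _ => (norm_nonneg _).trans (hM 0)) _
  · rw [Set.indicator_of_mem (mem_ball_zero_iff.2 (hρ y hy))]
    exact hM y

lemma norm_regKernel_mul_sub_le (hd : 2 ≤ d) (hM : ∀ y, ‖f y‖ ≤ M)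
    (hρ : ∀ y, f y ≠ 0 → ‖y‖ < ρ) {r : ℝ} {z : Euc d} (hz : ‖z‖ < r) {ε : ℝ} (hε : 0 ≤ ε)
    {y : Euc d} (hy : y ≠ z) :
    ‖regKernel d ε (z - y) * f y - regKernel d 0 (z - y) * f y‖
      ≤ ε * (coulombSlope d * (M * truncPow d (r + ρ) (z - y))) := by
  rw [← sub_mul, norm_mul, Real.norm_eq_abs (_ - _)]
  calc _ ≤ (ε * (coulombSlope d * ‖z - y‖ ^ ((1 : ℝ) - d))) * ‖f y‖ :=
        mul_le_mul_of_nonneg_right (abs_regKernel_sub_le hd hε (sub_ne_zero.2 hy.symm))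
          (norm_nonneg _)
    _ = ε * (coulombSlope d * (‖z - y‖ ^ ((1 : ℝ) - d) * ‖f y‖)) := by ring
    _ ≤ _ := mul_le_mul_of_nonneg_left (mul_le_mul_of_nonneg_left
        (rpow_norm_sub_mul_le hM hρ hz y) (coulombSlope_pos hd).le) hε

lemma ae_ne_of_two_le (hd : 2 ≤ d) (z : Euc d) : ∀ᵐ y : Euc d, y ≠ z := by
  have : Nonempty (Fin d) := ⟨⟨0, by omega⟩⟩
  exact Measure.ae_ne volume z

lemma integrable_regKernel_mul_of_ne_zero (hf : Measurable f) (hM : ∀ y, ‖f y‖ ≤ M)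
    (hρ : ∀ y, f y ≠ 0 → ‖y‖ < ρ) {ε : ℝ} (hε : ε ≠ 0) (z : Euc d) :
    Integrable fun y => regKernel d ε (z - y) * f y := by
  have hc : Continuous fun y : Euc d => regKernel d ε (z - y) :=
    (continuous_regKernel d hε).comp (by fun_prop)
  obtain ⟨C, hC⟩ := (isCompact_closedBall (0 : Euc d) ρ).exists_bound_of_continuousOn
    hc.continuousOn
  refine ((integrable_of_bdd_of_support hf hM hρ).norm.const_mul C).mono'
    (hc.measurable.mul hf).aestronglyMeasurable (Eventually.of_forall fun y => ?_)
  rw [norm_mul]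
  by_cases hy : f y = 0
  · simp [hy]
  · exact mul_le_mul_of_nonneg_right (hC y (mem_closedBall_zero_iff.2 (hρ y hy).le))
      (norm_nonneg _)

lemma integrable_regKernel_zero_mul (hd : 2 ≤ d) (hf : Measurable f) (hM : ∀ y, ‖f y‖ ≤ M)
    (hρ : ∀ y, f y ≠ 0 → ‖y‖ < ρ) (z : Euc d) :
    Integrable fun y => regKernel d 0 (z - y) * f y := by
  have h1 := integrable_regKernel_mul_of_ne_zero hf hM hρ one_ne_zero z
  have hmeas : ∀ ε, AEStronglyMeasurable (fun y => regKernel d ε (z - y) * f y) volume :=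
    fun ε => (((measurable_regKernel d ε).comp
      (measurable_const.sub measurable_id)).mul hf).aestronglyMeasurable
  have h2 : Integrable fun y => regKernel d 1 (z - y) * f y - regKernel d 0 (z - y) * f y :=
    ((integrable_truncPow_sub (M := M) hd (‖z‖ + 1 + ρ) z).const_mul 1).mono'
      ((hmeas 1).sub (hmeas 0)) ((ae_ne_of_two_le hd z).mono fun y hy =>
        norm_regKernel_mul_sub_le hd hM hρ (lt_add_one _) zero_le_one hy)
  exact (h1.sub h2).congr (Eventually.of_forall fun y => by simp)

lemma hasGradientAt_integral_regKernel_mul (hd : 2 ≤ d) (hf : Measurable f)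
    (hM : ∀ y, ‖f y‖ ≤ M) (hρ : ∀ y, f y ≠ 0 → ‖y‖ < ρ) {ε : ℝ} (hε : 0 < ε) (z : Euc d) :
    HasGradientAt (fun z => ∫ y, regKernel d ε (z - y) * f y)
      (∫ y, f y • regGrad d ε (z - y)) z := by
  rw [hasGradientAt_iff_hasFDerivAt]
  have key := hasFDerivAt_integral_of_dominated_of_fderiv_le (𝕜 := ℝ) (μ := volume)
    (F := fun z y => regKernel d ε (z - y) * f y)
    (F' := fun z y => innerSL ℝ (f y • regGrad d ε (z - y)))
    (x₀ := z) (s := Set.univ) (bound := fun y => ‖f y‖ * (coulombSlope d * ε ^ ((1 : ℝ) - d)))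
    univ_mem
    (Eventually.of_forall fun z =>
      (integrable_regKernel_mul_of_ne_zero hf hM hρ hε.ne' z).aestronglyMeasurable)
    (integrable_regKernel_mul_of_ne_zero hf hM hρ hε.ne' z)
    ((innerSL ℝ).continuous.comp_aestronglyMeasurable
      (integrable_smul_regGrad hd hf hM hρ ε z).aestronglyMeasurable)
    (Eventually.of_forall fun y z _ => by
      rw [innerSL_apply_norm, norm_smul]
      exact mul_le_mul_of_nonneg_left (norm_regGrad_le_const hd hε _) (norm_nonneg _))
    ((integrable_of_bdd_of_support hf hM hρ).norm.mul_const _)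
    (Eventually.of_forall fun y z _ => by
      have h := (hasGradientAt_regKernel d (ε := ε) (x := z - y) (by positivity)).hasFDerivAt
      have h2 := (h.comp z ((hasFDerivAt_id z).sub_const y)).mul_const (f y)
      refine HasFDerivAt.congr_fderiv h2 ?_
      ext v
      simp)
  refine HasFDerivAt.congr_fderiv key ?_
  rw [ContinuousLinearMap.integral_comp_comm _ (integrable_smul_regGrad hd hf hM hρ ε z)]
  rfl

lemma tendsto_integral_regKernel_mul (hd : 2 ≤ d) (hf : Measurable f)
    (hM : ∀ y, ‖f y‖ ≤ M) (hρ : ∀ y, f y ≠ 0 → ‖y‖ < ρ) {ε : ℕ → ℝ} (hε : ∀ n, 0 < ε n)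
    (hlim : Tendsto ε atTop (𝓝 0)) (z : Euc d) :
    Tendsto (fun n => ∫ y, regKernel d (ε n) (z - y) * f y) atTop
      (𝓝 (∫ y, regKernel d 0 (z - y) * f y)) := by
  set C := ∫ y, coulombSlope d * (M * truncPow d (‖z‖ + 1 + ρ) (z - y))
  rw [tendsto_iff_norm_sub_tendsto_zero]
  refine squeeze_zero (fun _ => norm_nonneg _) (fun n => ?_)
    (by simpa using hlim.mul_const C : Tendsto (fun n => ε n * C) atTop (𝓝 0))
  rw [← integral_sub (integrable_regKernel_mul_of_ne_zero hf hM hρ (hε n).ne' z)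
    (integrable_regKernel_zero_mul hd hf hM hρ z), ← integral_const_mul]
  exact norm_integral_le_of_norm_le
    ((integrable_truncPow_sub hd _ z).const_mul _) ((ae_ne_of_two_le hd z).mono fun y hy =>
      norm_regKernel_mul_sub_le hd hM hρ (lt_add_one _) (hε n).le hy)

/-- The error made by regularising the gradient, truncated to the ball of radius `R`. -/
def truncGradError (d : ℕ) (R ε : ℝ) : Euc d → ℝ :=
  (ball (0 : Euc d) R).indicator fun u => ‖regGrad d ε u - regGrad d 0 u‖

lemma truncGradError_nonneg (R ε : ℝ) (u : Euc d) : 0 ≤ truncGradError d R ε u :=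
  Set.indicator_nonneg (fun _ _ => norm_nonneg _) u

lemma norm_truncGradError_le (hd : 2 ≤ d) (R ε : ℝ) (u : Euc d) :
    ‖truncGradError d R ε u‖ ≤ 2 * coulombSlope d * truncPow d R u := by
  by_cases hu : u ∈ ball (0 : Euc d) R
  · rw [truncGradError, truncPow, Set.indicator_of_mem hu, Set.indicator_of_mem hu, norm_norm]
    refine (norm_sub_le _ _).trans ?_
    have h1 := norm_regGrad_le hd ε u
    have h2 := norm_regGrad_le hd 0 u
    linarith
  · simp [truncGradError, truncPow, Set.indicator_of_notMem hu]

lemma aestronglyMeasurable_truncGradError (R ε : ℝ) :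
    AEStronglyMeasurable (truncGradError d R ε) volume :=
  (((measurable_regGrad d ε).sub (measurable_regGrad d 0)).norm.indicator
    measurableSet_ball).aestronglyMeasurable

lemma integrable_truncGradError (hd : 2 ≤ d) (R ε : ℝ) : Integrable (truncGradError d R ε) :=
  ((integrable_truncPow hd R).const_mul (2 * coulombSlope d)).mono'
    (aestronglyMeasurable_truncGradError R ε)
    (Eventually.of_forall (norm_truncGradError_le hd R ε))

lemma tendsto_integral_truncGradError (hd : 2 ≤ d) {ε : ℕ → ℝ}
    (hlim : Tendsto ε atTop (𝓝 0)) (R : ℝ) :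
    Tendsto (fun n => ∫ u, truncGradError d R (ε n) u) atTop (𝓝 0) := by
  have h := tendsto_integral_of_dominated_convergence (μ := (volume : Measure (Euc d)))
    (F := fun n => truncGradError d R (ε n)) (f := fun _ => 0)
    (fun u => 2 * coulombSlope d * truncPow d R u)
    (fun n => aestronglyMeasurable_truncGradError R (ε n))
    ((integrable_truncPow hd R).const_mul _)
    (fun n => Eventually.of_forall (norm_truncGradError_le hd R (ε n)))
    (Eventually.of_forall fun u => by
      by_cases hu : u ∈ ball (0 : Euc d) R
      · simp only [truncGradError, Set.indicator_of_mem hu]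
        exact tendsto_iff_norm_sub_tendsto_zero.1 (tendsto_regGrad d hlim u)
      · simp [truncGradError, Set.indicator_of_notMem hu])
  simpa using h

/-- The Coulomb potential of a bounded compactly supported density is differentiable, and its
gradient is obtained by differentiating the kernel. -/
lemma hasGradientAt_integral_ck_mul (hd : 2 ≤ d) (hf : Measurable f)
    (hM : ∀ y, ‖f y‖ ≤ M) (hρ : ∀ y, f y ≠ 0 → ‖y‖ < ρ) (z : Euc d) :
    HasGradientAt (fun z => ∫ y, ck d (z - y) * f y) (∫ y, f y • regGrad d 0 (z - y)) z := by
  rw [ck_eq_regKernel]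
  obtain ⟨ε, -, hε, hlim⟩ := exists_seq_strictAnti_tendsto (0 : ℝ)
  have hM0 : 0 ≤ M := (norm_nonneg _).trans (hM 0)
  set R := ‖z‖ + 1 + ρ
  have hunif : TendstoUniformlyOn
      (fun n z => InnerProductSpace.toDual ℝ (Euc d) (∫ y, f y • regGrad d (ε n) (z - y)))
      (fun z => InnerProductSpace.toDual ℝ (Euc d) (∫ y, f y • regGrad d 0 (z - y)))
      atTop (ball (0 : Euc d) (‖z‖ + 1)) := by
    have h0 := (tendsto_integral_truncGradError hd hlim R).const_mul M
    rw [mul_zero] at h0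
    rw [Metric.tendstoUniformlyOn_iff]
    intro δ hδ
    filter_upwards [h0.eventually (gt_mem_nhds hδ)] with n hn x hx
    refine lt_of_le_of_lt ?_ hn
    rw [(InnerProductSpace.toDual ℝ (Euc d)).dist_map, dist_comm, dist_eq_norm,
      ← integral_sub (integrable_smul_regGrad hd hf hM hρ _ x)
        (integrable_smul_regGrad hd hf hM hρ _ x), ← integral_const_mul,
      ← integral_sub_left_eq_self (fun u => M * truncGradError d R (ε n) u) volume x]
    refine norm_integral_le_of_norm_le
      (((integrable_truncGradError hd R (ε n)).const_mul M).comp_sub_left x)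
      (Eventually.of_forall fun y => ?_)
    rw [← smul_sub, norm_smul]
    by_cases hy : f y = 0
    · rw [hy, norm_zero, zero_mul]
      exact mul_nonneg hM0 (truncGradError_nonneg _ _ _)
    · have hmem : x - y ∈ ball (0 : Euc d) R := by
        rw [mem_ball_zero_iff] at hx ⊢
        exact (norm_sub_le _ _).trans_lt (add_lt_add hx (hρ y hy))
      rw [truncGradError, Set.indicator_of_mem hmem]
      exact mul_le_mul_of_nonneg_right (hM y) (norm_nonneg _)
  rw [hasGradientAt_iff_hasFDerivAt]
  exact hasFDerivAt_of_tendstoUniformlyOn isOpen_ball hunif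
    (fun n x _ => (hasGradientAt_integral_regKernel_mul hd hf hM hρ (hε n) x).hasFDerivAt)
    (fun x _ => tendsto_integral_regKernel_mul hd hf hM hρ hε hlim x)
    (mem_ball_zero_iff.2 (lt_add_one _))

end Convolution

lemma cConst_eq (d : ℕ) :
    cConst d = coulombSlope d * (d * (volume : Measure (Euc d)).real (ball 0 1)) := by
  unfold cConst coulombSlope
  split_ifs with h
  · subst h
    rw [measureReal_def, EuclideanSpace.volume_ball_fin_two]
    simp [Real.pi_pos.le]
  · rw [measureReal_def]
    ring

lemma cConst_pos {d : ℕ} (hd : 2 ≤ d) : 0 < cConst d := by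
  have : Nonempty (Fin d) := ⟨⟨0, by omega⟩⟩
  rw [cConst_eq]
  have h1 : 0 < (volume : Measure (Euc d)).real (ball 0 1) :=
    ENNReal.toReal_pos (measure_ball_pos _ _ one_pos).ne' measure_ball_lt_top.ne
  have h2 : (0 : ℝ) < d := by exact_mod_cast (by omega : 0 < d)
  exact mul_pos (coulombSlope_pos hd) (mul_pos h2 h1)

lemma HasCompactSupport.exists_norm_lt {E F : Type*} [NormedAddCommGroup E] [Zero F]
    {f : E → F} (hf : HasCompactSupport f) : ∃ r, ∀ x, f x ≠ 0 → ‖x‖ < r := by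
  obtain ⟨r, hr⟩ := hf.isCompact.isBounded.subset_ball (0 : E)
  exact ⟨r, fun x hx => mem_ball_zero_iff.1 (hr (subset_tsupport f hx))⟩

section TestFunction

variable {d : ℕ} {φ : Euc d → ℝ}

lemma inner_gradient_eq_fderiv (φ : Euc d → ℝ) (x v : Euc d) :
    inner ℝ (gradient φ x) v = fderiv ℝ φ x v := by
  simp [gradient]

lemma ContDiff.continuous_gradient (hφ : ContDiff ℝ 1 φ) : Continuous (gradient φ) :=
  (InnerProductSpace.toDual ℝ (Euc d)).symm.continuous.comp (hφ.continuous_fderiv one_ne_zero)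

lemma HasCompactSupport.gradient (hφ : HasCompactSupport φ) :
    HasCompactSupport (gradient φ) :=
  (hφ.fderiv ℝ).comp_left (g := (InnerProductSpace.toDual ℝ (Euc d)).symm) (map_zero _)

lemma integrable_inner_gradient_smul_regGrad (hd : 2 ≤ d) (hφ : ContDiff ℝ 1 φ)
    (hφc : HasCompactSupport φ) (a : Euc d) :
    Integrable fun z => inner ℝ (gradient φ z) (regGrad d 0 (z - a)) := by
  obtain ⟨r, hr⟩ := hφc.gradient.exists_norm_lt
  obtain ⟨C, hC⟩ := hφ.continuous_gradient.bounded_above_of_compact_support hφc.gradient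
  have hmeas : Measurable fun z => inner ℝ (gradient φ z) (regGrad d 0 (z - a)) :=
    hφ.continuous_gradient.measurable.inner ((measurable_regGrad d 0).comp (by fun_prop))
  refine (((integrable_truncPow hd (r + ‖a‖)).comp_sub_right a).const_mul
    (C * coulombSlope d)).mono' hmeas.aestronglyMeasurable (Eventually.of_forall fun z => ?_)
  have hC0 : 0 ≤ C := (norm_nonneg _).trans (hC 0)
  by_cases hz : gradient φ z = 0
  · rw [hz, inner_zero_left, norm_zero]
    exact mul_nonneg (mul_nonneg hC0 (coulombSlope_pos hd).le) (truncPow_nonneg _ _ _)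
  · have hmem : z - a ∈ ball (0 : Euc d) (r + ‖a‖) := by
      rw [mem_ball_zero_iff]
      exact (norm_sub_le _ _).trans_lt (by linarith [hr z hz])
    rw [truncPow, Set.indicator_of_mem hmem, mul_assoc]
    exact (norm_inner_le_norm _ _).trans
      (mul_le_mul (hC z) (norm_regGrad_le hd 0 _) (norm_nonneg _) hC0)

lemma regGrad_zero_smul {r : ℝ} (hr : 0 < r) {ω : Euc d} (hω : ‖ω‖ = 1) :
    regGrad d 0 (r • ω) = (-coulombSlope d * r ^ ((1 : ℝ) - d)) • ω := by
  rw [regGrad, norm_smul, hω, mul_one, Real.norm_of_nonneg hr.le, zero_pow two_ne_zero, add_zero,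
    Real.sqrt_sq hr.le, smul_smul, mul_assoc, ← Real.rpow_add_one hr.ne']
  ring_nf

lemma integral_volumeIoiPow (n : ℕ) (g : ℝ → ℝ) :
    ∫ r : Set.Ioi (0 : ℝ), g r ∂(Measure.volumeIoiPow n) = ∫ r in Set.Ioi (0 : ℝ), r ^ n * g r := by
  simp only [Measure.volumeIoiPow, ENNReal.ofReal]
  rw [integral_withDensity_eq_integral_smul,
    integral_subtype_comap measurableSet_Ioi fun a ↦ Real.toNNReal (a ^ n) • g a,
    setIntegral_congr_fun measurableSet_Ioi fun x hx ↦ ?_]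
  · rw [NNReal.smul_def, Real.coe_toNNReal _ (pow_nonneg (le_of_lt hx) _), smul_eq_mul]
  · exact (measurable_subtype_coe.pow_const _).real_toNNReal

lemma integral_Ioi_inner_gradient_regGrad (hd : 2 ≤ d) (hφ : ContDiff ℝ 1 φ)
    (hφc : HasCompactSupport φ) {ω : Euc d} (hω : ‖ω‖ = 1) :
    ∫ r in Set.Ioi (0 : ℝ), r ^ (d - 1) * inner ℝ (gradient φ (r • ω)) (regGrad d 0 (r • ω))
      = coulombSlope d * φ 0 := by
  have hψ : ContDiff ℝ 1 fun r : ℝ => φ (r • ω) := by fun_prop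
  have hψc : HasCompactSupport fun r : ℝ => φ (r • ω) := by
    obtain ⟨R, hR⟩ := hφc.exists_norm_lt
    refine HasCompactSupport.intro (isCompact_closedBall (0 : ℝ) R) fun r hr => ?_
    by_contra h
    have := hR _ h
    rw [norm_smul, hω, mul_one] at this
    exact hr (mem_closedBall_zero_iff.2 this.le)
  have h := hψc.integral_Ioi_deriv_eq hψ 0
  have hcongr : ∀ r ∈ Set.Ioi (0 : ℝ),
      r ^ (d - 1) * inner ℝ (gradient φ (r • ω)) (regGrad d 0 (r • ω))
        = -coulombSlope d * deriv (fun r : ℝ => φ (r • ω)) r := by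
    intro r hr
    have hr : 0 < r := hr
    have hder : HasDerivAt (fun r : ℝ => φ (r • ω)) (fderiv ℝ φ (r • ω) ω) r := by
      have h1 := (hφ.differentiable one_ne_zero (r • ω)).hasFDerivAt
      have h2 : HasDerivAt (fun r : ℝ => r • ω) ω r := by
        simpa using (hasDerivAt_id r).smul_const ω
      exact h1.comp_hasDerivAt r h2
    have hpow : r ^ (d - 1) * r ^ ((1 : ℝ) - d) = 1 := by
      rw [← Real.rpow_natCast, ← Real.rpow_add hr, Nat.cast_sub (by omega)]
      simp
    rw [hder.deriv, regGrad_zero_smul hr hω, inner_smul_right, inner_gradient_eq_fderiv]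
    linear_combination (-coulombSlope d * fderiv ℝ φ (r • ω) ω) * hpow
  rw [setIntegral_congr_fun measurableSet_Ioi hcongr, integral_const_mul, h]
  simp

/-- The Coulomb kernel is `c_d` times the fundamental solution of `-Δ`, tested at the origin. -/
lemma integral_inner_gradient_regGrad_zero (hd : 2 ≤ d) (hφ : ContDiff ℝ 1 φ)
    (hφc : HasCompactSupport φ) :
    ∫ z, inner ℝ (gradient φ z) (regGrad d 0 z) = cConst d * φ 0 := by
  have : Nonempty (Fin d) := ⟨⟨0, by omega⟩⟩
  set F : Euc d → ℝ := fun z => inner ℝ (gradient φ z) (regGrad d 0 z) with hF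
  let g : sphere (0 : Euc d) 1 × Set.Ioi (0 : ℝ) → ℝ := fun p => F (p.2.1 • p.1.1)
  have hint : Integrable F := by
    simpa only [sub_zero] using integrable_inner_gradient_smul_regGrad hd hφ hφc 0
  have hmp := (volume : Measure (Euc d)).measurePreserving_homeomorphUnitSphereProd
  have hemb := (homeomorphUnitSphereProd (Euc d)).measurableEmbedding
  have hg : ∀ x : ({0}ᶜ : Set (Euc d)), g (homeomorphUnitSphereProd (Euc d) x) = F x := by
    intro x
    have hx : ‖(x : Euc d)‖ ≠ 0 := norm_ne_zero_iff.2 x.2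
    simp only [g, homeomorphUnitSphereProd_apply_snd_coe, homeomorphUnitSphereProd_apply_fst_coe]
    rw [smul_inv_smul₀ hx]
  have hgint : Integrable g ((volume : Measure (Euc d)).toSphere.prod
      (Measure.volumeIoiPow (Module.finrank ℝ (Euc d) - 1))) := by
    rw [← hmp.integrable_comp_emb hemb]
    have h1 : IntegrableOn F ({0}ᶜ : Set (Euc d)) := hint.integrableOn
    rw [integrableOn_iff_comap_subtypeVal (measurableSet_singleton _).compl] at h1
    exact h1.congr (Eventually.of_forall fun x => (hg x).symm)
  calc ∫ z, F z = ∫ x : ({0}ᶜ : Set (Euc d)), F x ∂((volume : Measure (Euc d)).comap (↑)) := by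
        rw [integral_subtype_comap (measurableSet_singleton _).compl F, restrict_compl_singleton]
    _ = ∫ p, g p ∂((volume : Measure (Euc d)).toSphere.prod
          (Measure.volumeIoiPow (Module.finrank ℝ (Euc d) - 1))) := by
        rw [← hmp.integral_comp hemb]
        exact integral_congr_ae (Eventually.of_forall fun x => (hg x).symm)
    _ = ∫ _ : sphere (0 : Euc d) 1, coulombSlope d * φ 0 ∂(volume : Measure (Euc d)).toSphere := by
        rw [integral_prod _ hgint]
        refine integral_congr_ae (Eventually.of_forall fun ω => ?_)
        simp only [g, finrank_euclideanSpace, Fintype.card_fin]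
        rw [integral_volumeIoiPow (d - 1) (fun r => F (r • (ω : Euc d)))]
        exact integral_Ioi_inner_gradient_regGrad hd hφ hφc (norm_eq_of_mem_sphere ω)
    _ = cConst d * φ 0 := by
        rw [integral_const, Measure.toSphere_real_apply_univ, cConst_eq, finrank_euclideanSpace,
          Fintype.card_fin, smul_eq_mul]
        ring

lemma integral_inner_gradient_regGrad_sub (hd : 2 ≤ d) (hφ : ContDiff ℝ 1 φ)
    (hφc : HasCompactSupport φ) (a : Euc d) :
    ∫ z, inner ℝ (gradient φ z) (regGrad d 0 (z - a)) = cConst d * φ a := by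
  have h := integral_inner_gradient_regGrad_zero hd (φ := fun z => φ (z + a)) (by fun_prop)
    (hφc.comp_homeomorph (Homeomorph.addRight a))
  rw [zero_add] at h
  rw [← h, ← integral_add_right_eq_self _ a]
  refine integral_congr_ae (Eventually.of_forall fun z => ?_)
  simp only [add_sub_cancel_right, inner_gradient_eq_fderiv, fderiv_comp_add_right]

variable {f : Euc d → ℝ} {M ρ : ℝ}

lemma integrable_prod_inner_gradient_smul_regGrad (hd : 2 ≤ d) (hφ : ContDiff ℝ 1 φ)
    (hφc : HasCompactSupport φ) (hf : Measurable f) (hM : ∀ y, ‖f y‖ ≤ M)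
    (hρ : ∀ y, f y ≠ 0 → ‖y‖ < ρ) :
    Integrable (fun p : Euc d × Euc d =>
      inner ℝ (gradient φ p.1) (f p.2 • regGrad d 0 (p.1 - p.2))) (volume.prod volume) := by
  obtain ⟨r, hr⟩ := hφc.gradient.exists_norm_lt
  obtain ⟨C, hC⟩ := hφ.continuous_gradient.bounded_above_of_compact_support hφc.gradient
  have hC0 : 0 ≤ C := (norm_nonneg _).trans (hC 0)
  have hmeas : Measurable fun p : Euc d × Euc d =>
      inner ℝ (gradient φ p.1) (f p.2 • regGrad d 0 (p.1 - p.2)) :=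
    (hφ.continuous_gradient.measurable.comp measurable_fst).inner
      ((hf.comp measurable_snd).smul ((measurable_regGrad d 0).comp (by fun_prop)))
  have hconv := (integrable_of_bdd_of_support hf hM hρ).norm.convolution_integrand
    (ContinuousLinearMap.mul ℝ ℝ) (integrable_truncPow hd (r + ρ))
  refine (hconv.const_mul (C * coulombSlope d)).mono' hmeas.aestronglyMeasurable
    (Eventually.of_forall fun p => ?_)
  simp only [ContinuousLinearMap.mul_apply']
  have hnonneg : 0 ≤ C * coulombSlope d * (‖f p.2‖ * truncPow d (r + ρ) (p.1 - p.2)) :=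
    mul_nonneg (mul_nonneg hC0 (coulombSlope_pos hd).le)
      (mul_nonneg (norm_nonneg _) (truncPow_nonneg _ _ _))
  by_cases hz : gradient φ p.1 = 0
  · rwa [hz, inner_zero_left, norm_zero]
  by_cases hy : f p.2 = 0
  · have h0 : ‖inner ℝ (gradient φ p.1) (f p.2 • regGrad d 0 (p.1 - p.2))‖ = 0 := by
      rw [hy, zero_smul, inner_zero_right, norm_zero]
    rw [h0]
    exact hnonneg
  have hmem : p.1 - p.2 ∈ ball (0 : Euc d) (r + ρ) := by
    rw [mem_ball_zero_iff]
    exact (norm_sub_le _ _).trans_lt (add_lt_add (hr _ hz) (hρ _ hy))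
  rw [truncPow, Set.indicator_of_mem hmem, inner_smul_right, norm_mul]
  calc ‖f p.2‖ * ‖inner ℝ (gradient φ p.1) (regGrad d 0 (p.1 - p.2))‖
      ≤ ‖f p.2‖ * (C * (coulombSlope d * ‖p.1 - p.2‖ ^ ((1 : ℝ) - d))) :=
        mul_le_mul_of_nonneg_left ((norm_inner_le_norm _ _).trans
          (mul_le_mul (hC _) (norm_regGrad_le hd 0 _) (norm_nonneg _) hC0)) (norm_nonneg _)
    _ = _ := by ring

lemma inner_gradient_integral_smul_regGrad (hd : 2 ≤ d) (hf : Measurable f)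
    (hM : ∀ y, ‖f y‖ ≤ M) (hρ : ∀ y, f y ≠ 0 → ‖y‖ < ρ) (z : Euc d) :
    inner ℝ (gradient φ z) (∫ y, f y • regGrad d 0 (z - y))
      = ∫ y, inner ℝ (gradient φ z) (f y • regGrad d 0 (z - y)) :=
  (integral_inner (integrable_smul_regGrad hd hf hM hρ 0 z) _).symm

lemma integrable_inner_gradient_integral_smul_regGrad (hd : 2 ≤ d) (hφ : ContDiff ℝ 1 φ)
    (hφc : HasCompactSupport φ) (hf : Measurable f) (hM : ∀ y, ‖f y‖ ≤ M)
    (hρ : ∀ y, f y ≠ 0 → ‖y‖ < ρ) :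
    Integrable fun z => inner ℝ (gradient φ z) (∫ y, f y • regGrad d 0 (z - y)) := by
  simp_rw [inner_gradient_integral_smul_regGrad hd hf hM hρ]
  exact (integrable_prod_inner_gradient_smul_regGrad hd hφ hφc hf hM hρ).integral_prod_left

lemma integral_inner_gradient_integral_smul_regGrad (hd : 2 ≤ d) (hφ : ContDiff ℝ 1 φ)
    (hφc : HasCompactSupport φ) (hf : Measurable f) (hM : ∀ y, ‖f y‖ ≤ M)
    (hρ : ∀ y, f y ≠ 0 → ‖y‖ < ρ) :
    ∫ z, inner ℝ (gradient φ z) (∫ y, f y • regGrad d 0 (z - y))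
      = cConst d * ∫ y, φ y * f y := by
  simp_rw [inner_gradient_integral_smul_regGrad hd hf hM hρ]
  rw [integral_integral_swap (integrable_prod_inner_gradient_smul_regGrad hd hφ hφc hf hM hρ),
    ← integral_const_mul]
  refine integral_congr_ae (Eventually.of_forall fun y => ?_)
  simp only [inner_smul_right]
  rw [integral_const_mul, integral_inner_gradient_regGrad_sub hd hφ hφc]
  ring

end TestFunction

section Potential

variable {d n : ℕ} {f : Euc d → ℝ} {M ρ : ℝ}

/-- The potential of the configuration `x` relative to the background density `n f`. -/
def relPotential (d n : ℕ) (f : Euc d → ℝ) (x : Fin n → Euc d) (z : Euc d) : ℝ :=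
  (∑ i, ck d (z - x i)) - (n : ℝ) * ∫ y, ck d (z - y) * f y

/-- The gradient of the relative potential away from the points of the configuration. -/
def relField (d n : ℕ) (f : Euc d → ℝ) (x : Fin n → Euc d) (z : Euc d) : Euc d :=
  (∑ i, regGrad d 0 (z - x i)) - (n : ℝ) • ∫ y, f y • regGrad d 0 (z - y)

lemma hasGradientAt_relPotential (hd : 2 ≤ d) (hf : Measurable f)
    (hM : ∀ y, ‖f y‖ ≤ M) (hρ : ∀ y, f y ≠ 0 → ‖y‖ < ρ) (x : Fin n → Euc d) {z : Euc d}
    (hz : ∀ i, z ≠ x i) : HasGradientAt (relPotential d n f x) (relField d n f x z) z := by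
  have h1 : ∀ i, HasFDerivAt (fun z => ck d (z - x i))
      (InnerProductSpace.toDual ℝ (Euc d) (regGrad d 0 (z - x i))) z := by
    intro i
    have hpos : 0 < ‖z - x i‖ := norm_pos_iff.2 (sub_ne_zero.2 (hz i))
    rw [ck_eq_regKernel]
    exact (hasGradientAt_regKernel d (ε := 0) (x := z - x i) (by positivity)).hasFDerivAt.comp z
      ((hasFDerivAt_id z).sub_const (x i))
  have h2 := (hasGradientAt_integral_ck_mul hd hf hM hρ z).hasFDerivAt
  rw [hasGradientAt_iff_hasFDerivAt]
  refine HasFDerivAt.congr_fderiv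
    ((HasFDerivAt.fun_sum fun i (_ : i ∈ Finset.univ) => h1 i).sub (h2.const_mul (n : ℝ))) ?_
  simp [relField]

lemma gradient_relPotential_ae_eq (hd : 2 ≤ d) (hf : Measurable f)
    (hM : ∀ y, ‖f y‖ ≤ M) (hρ : ∀ y, f y ≠ 0 → ‖y‖ < ρ) (x : Fin n → Euc d) :
    gradient (relPotential d n f x) =ᵐ[volume] relField d n f x := by
  filter_upwards [ae_all_iff.2 fun i => ae_ne_of_two_le hd (x i)] with z hz
  exact (hasGradientAt_relPotential hd hf hM hρ x hz).gradient

lemma aestronglyMeasurable_relField (hf : Measurable f) (x : Fin n → Euc d) :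
    AEStronglyMeasurable (relField d n f x) volume := by
  have h1 : Measurable fun z => ∑ i, regGrad d 0 (z - x i) :=
    Finset.measurable_sum _ fun i _ => (measurable_regGrad d 0).comp (by fun_prop)
  have h2 : Measurable fun p : Euc d × Euc d => f p.2 • regGrad d 0 (p.1 - p.2) :=
    (hf.comp measurable_snd).smul ((measurable_regGrad d 0).comp (by fun_prop))
  have h3 : StronglyMeasurable fun z : Euc d => ∫ y, f y • regGrad d 0 (z - y) :=
    h2.stronglyMeasurable.integral_prod_right' (ν := volume)
  exact h1.aestronglyMeasurable.sub (h3.const_smul (n : ℝ)).aestronglyMeasurable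

lemma integral_inner_gradient_relField (hd : 2 ≤ d) {φ : Euc d → ℝ} (hφ : ContDiff ℝ 1 φ)
    (hφc : HasCompactSupport φ) (hf : Measurable f) (hM : ∀ y, ‖f y‖ ≤ M)
    (hρ : ∀ y, f y ≠ 0 → ‖y‖ < ρ) (x : Fin n → Euc d) :
    ∫ z, inner ℝ (gradient φ z) (relField d n f x z)
      = cConst d * ((∑ i, φ (x i)) - n * ∫ y, φ y * f y) := by
  simp only [relField, inner_sub_right, inner_sum, inner_smul_right]
  rw [integral_sub
      (integrable_finsetSum _ fun i _ =>
        integrable_inner_gradient_smul_regGrad hd hφ hφc (x i))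
      ((integrable_inner_gradient_integral_smul_regGrad hd hφ hφc hf hM hρ).const_mul _),
    integral_finsetSum _ fun i _ => integrable_inner_gradient_smul_regGrad hd hφ hφc (x i),
    integral_const_mul, integral_inner_gradient_integral_smul_regGrad hd hφ hφc hf hM hρ]
  simp_rw [integral_inner_gradient_regGrad_sub hd hφ hφc]
  rw [← Finset.mul_sum]
  ring

/-- The discrepancy of a configuration, tested against `φ`, is controlled by the field. -/
lemma ofReal_abs_sum_sub_le (hd : 2 ≤ d) {φ : Euc d → ℝ} (hφ : ContDiff ℝ 1 φ)
    (hφc : HasCompactSupport φ) (hf : Measurable f) (hM : ∀ y, ‖f y‖ ≤ M)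
    (hρ : ∀ y, f y ≠ 0 → ‖y‖ < ρ) {p q : ℝ≥0∞} [ENNReal.HolderTriple p q 1]
    (x : Fin n → Euc d) :
    ENNReal.ofReal |(∑ i, φ (x i)) - n * ∫ y, φ y * f y|
      ≤ ENNReal.ofReal (cConst d)⁻¹ * eLpNorm (gradient φ) p volume *
        eLpNorm (gradient (relPotential d n f x)) q volume := by
  have hc := cConst_pos hd
  set D := (∑ i, φ (x i)) - n * ∫ y, φ y * f y
  have hD : D = (cConst d)⁻¹ * ∫ z, inner ℝ (gradient φ z) (relField d n f x z) := by
    rw [integral_inner_gradient_relField hd hφ hφc hf hM hρ, inv_mul_cancel_left₀ hc.ne']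
  have holder : eLpNorm (fun z => inner ℝ (gradient φ z) (relField d n f x z)) 1 volume
      ≤ 1 * eLpNorm (gradient φ) p volume * eLpNorm (relField d n f x) q volume :=
    eLpNorm_le_eLpNorm_mul_eLpNorm_of_nnnorm hφ.continuous_gradient.aestronglyMeasurable
      (aestronglyMeasurable_relField hf x) (fun a b => inner ℝ a b) 1
      (Eventually.of_forall fun z => by
        rw [one_mul]
        exact nnnorm_inner_le_nnnorm _ _)
  rw [one_mul] at holder
  rw [hD, abs_mul, abs_of_pos (inv_pos.2 hc), ENNReal.ofReal_mul (inv_pos.2 hc).le, mul_assoc,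
    eLpNorm_congr_ae (gradient_relPotential_ae_eq hd hf hM hρ x)]
  refine mul_le_mul_right (le_trans ?_ holder) _
  rw [eLpNorm_one_eq_lintegral_enorm, ← Real.enorm_eq_ofReal_abs]
  exact enorm_integral_le_lintegral_enorm _

end Potential

lemma integral_comp_apply_eq_of_map_perm {ι E : Type*} [Fintype ι] [DecidableEq ι]
    [MeasurableSpace E] {μ : Measure (ι → E)}
    (hsymm : ∀ σ : Equiv.Perm ι, Measure.map (fun x => x ∘ σ) μ = μ)
    {φ : E → ℝ} (hφ : StronglyMeasurable φ) (i j : ι) :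
    ∫ x, φ (x i) ∂μ = ∫ x, φ (x j) ∂μ := by
  have hmeas : Measurable fun x : ι → E => x ∘ Equiv.swap i j :=
    measurable_pi_lambda _ fun k => measurable_pi_apply _
  conv_lhs => rw [← hsymm (Equiv.swap i j)]
  have h := integral_map (μ := μ) hmeas.aemeasurable (f := fun x => φ (x i))
    (hφ.comp_measurable (measurable_pi_apply i)).aestronglyMeasurable
  rw [h]
  simp

/-- **Control of the empirical measure implies control of the first marginal.**
For a symmetric probability measure `μ` on `(ℝ^d)^n` with first marginal `μ^{(1)}`, a bounded
compactly supported probability density `μ₀`, and `h_n^x` the potential of the configuration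
`x` relative to `nμ₀`, for `1 ≤ q < d/(d−1)` and `p` the conjugate exponent of `q` and every
test function `φ`:
`|∫ φ dμ^{(1)} − ∫ φ μ₀| ≤ (c_d n)^{−1} ‖∇φ‖_{L^p} ∫ ‖∇h_n^x‖_{L^q} dμ(x)`,
where the right-hand side may be `+∞`. -/
theorem empirical_controls_first_marginal
    (d : ℕ) (hd : 2 ≤ d)
    (n : ℕ) (hn : 1 ≤ n)
    (μ : Measure (Fin n → Euc d)) [IsProbabilityMeasure μ]
    (hsymm : ∀ σ : Equiv.Perm (Fin n), Measure.map (fun x => x ∘ σ) μ = μ)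
    (μ₀ : Euc d → ℝ) (hμ₀meas : Measurable μ₀) (hμ₀nonneg : ∀ x, 0 ≤ μ₀ x)
    (hμ₀bdd : ∃ M : ℝ, ∀ x, μ₀ x ≤ M) (hμ₀supp : HasCompactSupport μ₀)
    (hμ₀mass : ∫ x, μ₀ x = 1)
    (q : ℝ) (hq1 : 1 ≤ q) (hq2 : q < d / ((d : ℝ) - 1))
    (p : ℝ≥0∞) (hpq : (ENNReal.ofReal q)⁻¹ + p⁻¹ = 1)
    (φ : Euc d → ℝ) (hφ : ContDiff ℝ (⊤ : ℕ∞) φ) (hφsupp : HasCompactSupport φ) :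
    ENNReal.ofReal
        |(∫ z, φ z ∂(Measure.map (fun x => x ⟨0, hn⟩) μ)) - ∫ z, φ z * μ₀ z|
      ≤ ENNReal.ofReal ((cConst d * n)⁻¹) * eLpNorm (gradient φ) p volume *
          ∫⁻ x, eLpNorm
              (gradient fun z => (∑ i, ck d (z - x i)) - (n : ℝ) * ∫ y, ck d (z - y) * μ₀ y)
              (ENNReal.ofReal q) volume ∂μ := by
  obtain ⟨M, hM⟩ := hμ₀bdd
  have hM' : ∀ y, ‖μ₀ y‖ ≤ M := fun y => by
    rw [Real.norm_of_nonneg (hμ₀nonneg y)]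
    exact hM y
  obtain ⟨ρ, hρ⟩ := hμ₀supp.exists_norm_lt
  have hφ1 : ContDiff ℝ 1 φ := hφ.of_le (by exact_mod_cast le_top)
  have : ENNReal.HolderTriple p (ENNReal.ofReal q) 1 := ⟨by rw [add_comm, hpq, inv_one]⟩
  have hn0 : (0 : ℝ) < n := by exact_mod_cast hn
  have hφm : StronglyMeasurable φ := hφ.continuous.measurable.stronglyMeasurable
  have hφint : ∀ i, Integrable (fun x : Fin n → Euc d => φ (x i)) μ := fun i => by
    obtain ⟨C, hC⟩ := hφ.continuous.bounded_above_of_compact_support hφsupp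
    exact (integrable_const C).mono'
      (hφm.comp_measurable (measurable_pi_apply i)).aestronglyMeasurable
      (Eventually.of_forall fun x => hC _)
  have hmarg : (∫ z, φ z ∂(Measure.map (fun x => x ⟨0, hn⟩) μ)) - ∫ z, φ z * μ₀ z
      = (n : ℝ)⁻¹ * ∫ x, ((∑ i, φ (x i)) - n * ∫ y, φ y * μ₀ y) ∂μ := by
    have heval : Measurable fun x : Fin n → Euc d => x ⟨0, hn⟩ := measurable_pi_apply _
    rw [integral_map heval.aemeasurable hφm.aestronglyMeasurable,
      integral_sub (integrable_finsetSum _ fun i _ => hφint i) (integrable_const _),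
      integral_finsetSum _ fun i _ => hφint i,
      Finset.sum_congr rfl fun i _ =>
        integral_comp_apply_eq_of_map_perm hsymm hφm i ⟨0, hn⟩]
    simp only [Finset.sum_const, Finset.card_univ, Fintype.card_fin, nsmul_eq_mul, integral_const,
      probReal_univ, one_smul]
    field_simp
  have hfin : eLpNorm (gradient φ) p volume ≠ ∞ :=
    (hφ1.continuous_gradient.memLp_of_hasCompactSupport hφsupp.gradient).eLpNorm_ne_top
  rw [hmarg, abs_mul, abs_of_pos (inv_pos.2 hn0), ENNReal.ofReal_mul (inv_pos.2 hn0).le]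
  calc ENNReal.ofReal (n : ℝ)⁻¹ *
        ENNReal.ofReal |∫ x, ((∑ i, φ (x i)) - n * ∫ y, φ y * μ₀ y) ∂μ|
      ≤ ENNReal.ofReal (n : ℝ)⁻¹ *
        ∫⁻ x, ENNReal.ofReal |(∑ i, φ (x i)) - n * ∫ y, φ y * μ₀ y| ∂μ := by
        simp_rw [← Real.enorm_eq_ofReal_abs]
        gcongr
        exact enorm_integral_le_lintegral_enorm _
    _ ≤ ENNReal.ofReal (n : ℝ)⁻¹ * ∫⁻ x, ENNReal.ofReal (cConst d)⁻¹ *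
          eLpNorm (gradient φ) p volume *
          eLpNorm (gradient (relPotential d n μ₀ x)) (ENNReal.ofReal q) volume ∂μ := by
        gcongr with x
        exact ofReal_abs_sum_sub_le hd hφ1 hφsupp hμ₀meas hM' hρ x
    _ = ENNReal.ofReal ((cConst d * n)⁻¹) * eLpNorm (gradient φ) p volume *
          ∫⁻ x, eLpNorm (gradient (relPotential d n μ₀ x)) (ENNReal.ofReal q) volume ∂μ := by
        rw [lintegral_const_mul' _ _ (ENNReal.mul_ne_top ENNReal.ofReal_ne_top hfin), mul_inv,
          ENNReal.ofReal_mul (inv_pos.2 (cConst_pos hd)).le]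
        ring
end
end
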